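/- Let F : W → ℝ be a class function that is C^{n+1}. Then: (i) for each f ∈ W there exists c_f ∈ [0,1] such that F(f) − Σ_{m=0}^n (1/m!)·d^mF(0; f, …, f) = d^{n+1}F(c_f·f; f, …, f)/(n+1)!. (ii) There exist unique scalars a_H, indexed by isomorphism classes H of multigraphs with at most n edges and no isolated vertices, such that for every 0 ≤ m ≤ n and every f ∈ ⋃_{σ∈S_{[0,1]}} σ(W_𝐩), (1/m!)·d^mF(0; f, …, f) = Σ_{H with m edges} a_H·t(H,f); if moreover each function f ↦ d^mF(0;f,…,f) is continuous in the L¹ topology, this identity holds for all f ∈ W. -/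

import Mathlib

open MeasureTheory Filter Set Topology
open scoped BigOperators Classical ENNReal

noncomputable section

/-- The type of kernels: functions `[0,1]² → ℝ` (formalized as functions on all of `ℝ²`). -/
abbrev Kern : Type := ℝ → ℝ → ℝ

/-- Lebesgue measure restricted to `[0,1]`. -/
abbrev μ01 : Measure ℝ := volume.restrict (Set.Icc 0 1)

/-- Symmetric measurable function. -/
def IsSymmMeas (f : Kern) : Prop :=
  Measurable (Function.uncurry f) ∧ ∀ x y, f x y = f y x

/-- Membership in the space `𝒲` of bounded symmetric measurable functions. -/
def IsKernel (f : Kern) : Prop := IsSymmMeas f ∧ ∃ C : ℝ, ∀ x y, |f x y| ≤ C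

/-- A graphon: a symmetric measurable function with values in `[0,1]`. -/
def IsGraphon (f : Kern) : Prop := IsSymmMeas f ∧ ∀ x y, f x y ∈ Set.Icc (0:ℝ) 1

/-- The set `W` of graphons. -/
def Graphons : Set Kern := {f | IsGraphon f}

/-- A multigraph (no loops, multiple edges allowed), with vertex set `Fin nv` and
edge (multi)set indexed by `Fin ne`, the edge `e` having endpoints `s e`, `t e`. -/
structure MG where
  nv : ℕ
  ne : ℕ
  s : Fin ne → Fin nv
  t : Fin ne → Fin nv
  noLoop : ∀ e, s e ≠ t e

/-- The homomorphism density `t(G, f)` of a multigraph `G` in a kernel `f`. -/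
def homDensity (G : MG) (f : Kern) : ℝ :=
  ∫ x : Fin G.nv → ℝ, ∏ e : Fin G.ne, f (x (G.s e)) (x (G.t e))
    ∂(Measure.pi fun _ => μ01)

/-- A node-and-edge homomorphism of multigraphs. -/
structure MGHom (G H : MG) where
  vMap : Fin G.nv → Fin H.nv
  eMap : Fin G.ne → Fin H.ne
  compat : ∀ e, ({H.s (eMap e), H.t (eMap e)} : Finset (Fin H.nv))
      = {vMap (G.s e), vMap (G.t e)}

/-- A surjective node-and-edge homomorphism. -/
def MGHom.Surj {G H : MG} (φ : MGHom G H) : Prop :=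
  Function.Surjective φ.vMap ∧ Function.Surjective φ.eMap

/-- A bijective node-and-edge homomorphism. -/
def MGHom.Bij {G H : MG} (φ : MGHom G H) : Prop :=
  Function.Bijective φ.vMap ∧ Function.Bijective φ.eMap

instance (G H : MG) : Finite (MGHom G H) := by
  have hinj : Function.Injective (fun φ : MGHom G H => (φ.vMap, φ.eMap)) := by
    rintro ⟨v1, e1, h1⟩ ⟨v2, e2, h2⟩ h
    simp only [Prod.mk.injEq] at h
    obtain ⟨hv, he⟩ := h
    subst hv; subst he; rfl
  exact Finite.of_injective _ hinj

/-- Isomorphism of multigraphs. -/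
def MGIso (G H : MG) : Prop := ∃ φ : MGHom G H, φ.Bij

/-- A multigraph with no isolated vertices. -/
def NoIsolated (G : MG) : Prop := ∀ v, ∃ e, G.s e = v ∨ G.t e = v

/-- A multigraph is simple if no two (distinct) edges have the same pair of endpoints. -/
def IsSimpleMG (G : MG) : Prop :=
  ∀ e e', ({G.s e, G.t e} : Finset (Fin G.nv)) = ({G.s e', G.t e'} : Finset (Fin G.nv))
    → e = e'

/-- A class function on graphon space: it only depends on the homomorphism densities
with respect to finite simple graphs. -/
def IsClassFun (F : Kern → ℝ) : Prop :=
  ∀ f g, IsGraphon f → IsGraphon g →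
    (∀ G : MG, IsSimpleMG G → homDensity G f = homDensity G g) → F f = F g

/-- The `L¹` distance between two kernels (on the square `[0,1]²`). -/
def l1Dist (f g : Kern) : ℝ := ∫ x, ∫ y, |f x y - g x y| ∂μ01 ∂μ01

/-- Continuity on the set of graphons with respect to the `L¹` norm. -/
def L1ContOn (F : Kern → ℝ) : Prop :=
  ∀ f ∈ Graphons, ∀ ε : ℝ, 0 < ε → ∃ δ : ℝ, 0 < δ ∧
    ∀ g ∈ Graphons, l1Dist f g < δ → |F f - F g| < ε

/-- The cut norm of a kernel. -/
def cutNorm (f : Kern) : ℝ :=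
  sSup {r : ℝ | ∃ S T : Set ℝ, MeasurableSet S ∧ MeasurableSet T ∧
    S ⊆ Set.Icc 0 1 ∧ T ⊆ Set.Icc 0 1 ∧ r = |∫ x in S, ∫ y in T, f x y|}

/-- Continuity on the set of graphons with respect to the cut norm. -/
def CutContOn (F : Kern → ℝ) : Prop :=
  ∀ f ∈ Graphons, ∀ ε : ℝ, 0 < ε → ∃ δ : ℝ, 0 < δ ∧
    ∀ g ∈ Graphons, cutNorm (f - g) < δ → |F f - F g| < ε

section Gateaux

variable {E : Type*} [AddCommGroup E] [Module ℝ E]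

/-- Admissible directions at `f` for a convex subset `U` of a real vector space:
directions `g` so that `f + ε g ∈ U` for all sufficiently small `ε ∈ [0,1)`. -/
def adm (U : Set E) (f : E) : Set E :=
  {g | ∃ ε₀ : ℝ, 0 < ε₀ ∧ ε₀ ≤ 1 ∧ ∀ ε : ℝ, 0 ≤ ε → ε < ε₀ → f + ε • g ∈ U}

/-- Iterated mixed Gâteaux derivative `d^n F(f; g₁, …, g_n)` of `F : U → ℝ`, computed
through one-sided difference quotients restricted to `U`; the derivative in the last
direction is taken first.  (The value is given by `Filter.limUnder`, i.e. it is the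
limit of the difference quotients whenever this limit exists.) -/
def gD (U : Set E) (F : E → ℝ) : (n : ℕ) → E → (Fin n → E) → ℝ
  | 0 => fun f _ => F f
  | n + 1 => fun f g =>
      limUnder (nhdsWithin (0:ℝ) {t : ℝ | t ≠ 0 ∧ f + t • g (Fin.last n) ∈ U})
        (fun t => (gD U F n (f + t • g (Fin.last n)) (fun i => g i.castSucc)
              - gD U F n f (fun i => g i.castSucc)) / t)

/-- `F` is `n` times Gâteaux differentiable on `U`: all iterated Gâteaux derivatives
up to order `n` in admissible directions exist (i.e. the corresponding difference
quotients genuinely converge). -/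
def GDiffN (U : Set E) (F : E → ℝ) : ℕ → Prop
  | 0 => True
  | n + 1 => GDiffN U F n ∧
      ∀ f ∈ U, ∀ g : Fin (n+1) → E, (∀ i, g i ∈ adm U f) →
        Tendsto
          (fun t : ℝ => (gD U F n (f + t • g (Fin.last n)) (fun i => g i.castSucc)
              - gD U F n f (fun i => g i.castSucc)) / t)
          (nhdsWithin (0:ℝ) {t : ℝ | t ≠ 0 ∧ f + t • g (Fin.last n) ∈ U})
          (nhds (gD U F (n+1) f g))

/-- `F : U → ℝ` is `C^n` at `f`: for any admissible directions `g₁, …, g_m`, the map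
`(λ₁, …, λ_m) ↦ F(f + Σᵢ λᵢ gᵢ)` admits a `C^n` extension to all of `ℝ^m`. -/
def IsCnAt (U : Set E) (F : E → ℝ) (n : ℕ) (f : E) : Prop :=
  ∀ (m : ℕ) (g : Fin m → E), (∀ i, g i ∈ adm U f) →
    ∃ G : (Fin m → ℝ) → ℝ, ContDiff ℝ n G ∧
      ∀ lam : Fin m → ℝ, f + ∑ i, lam i • g i ∈ U → G lam = F (f + ∑ i, lam i • g i)

/-- `F` is `C^n` (everywhere on `U`). -/
def IsCn (U : Set E) (F : E → ℝ) (n : ℕ) : Prop := ∀ f ∈ U, IsCnAt U F n f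

/-- `F` is Gâteaux smooth: `C^n` at every point for every `n`. -/
def GSmooth (U : Set E) (F : E → ℝ) : Prop := ∀ n : ℕ, IsCn U F n

end Gateaux

/-- Iso-invariance of a family of constants indexed by multigraphs. -/
def IsoInvariant (a : MG → ℝ) : Prop := ∀ G H, MGIso G H → a G = a H

/-- Coefficients indexed by the isomorphism classes of multigraphs with at most `N`
edges and no isolated vertices (encoded as iso-invariant families of constants
vanishing outside this class of multigraphs). -/
def GoodCoeffs (N : ℕ) (a : MG → ℝ) : Prop :=
  IsoInvariant a ∧ ∀ G : MG, ¬(G.ne ≤ N ∧ NoIsolated G) → a G = 0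

/-- A functional on `W^n` is multilinear if its restriction to tuples from the
subspace `𝒲` (= span of `W`) is linear in each coordinate. -/
def MultilinearOnKerns (n : ℕ) (Λ : (Fin n → Kern) → ℝ) : Prop :=
  (∀ (g : Fin n → Kern), (∀ j, IsKernel (g j)) → ∀ (i : Fin n) (u v : Kern),
      IsKernel u → IsKernel v →
      Λ (Function.update g i (u + v))
        = Λ (Function.update g i u) + Λ (Function.update g i v)) ∧
  (∀ (g : Fin n → Kern), (∀ j, IsKernel (g j)) → ∀ (i : Fin n) (c : ℝ) (u : Kern),
      IsKernel u →
      Λ (Function.update g i (c • u)) = c * Λ (Function.update g i u))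

/-- A functional on `W^n` extends to a multilinear functional on `(span ℝ W)^n`. -/
def IsMultilinearOnW (n : ℕ) (Λ : (Fin n → Kern) → ℝ) : Prop :=
  ∃ L : MultilinearMap ℝ (fun _ : Fin n => ↥(Submodule.span ℝ Graphons)) ℝ,
    ∀ (g : Fin n → Kern) (h : ∀ i, g i ∈ Graphons),
      L (fun i => ⟨g i, Submodule.subset_span (h i)⟩) = Λ g

/-- An invertible Lebesgue-measure-preserving bijection of `[0,1]`. -/
def IsMPB (σ : ℝ → ℝ) : Prop :=
  MeasurePreserving σ μ01 μ01 ∧ Set.BijOn σ (Set.Icc 0 1) (Set.Icc 0 1)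

/-- The action `f ↦ f^σ` of maps of `[0,1]` on kernels. -/
def Kern.translate (σ : ℝ → ℝ) (f : Kern) : Kern := fun x y => f (σ x) (σ y)

/-- The cell `((a)/p, (a+1)/p]` of the regular partition of `[0,1]` (`a = 0, …, p-1`). -/
def cell (p : ℕ) (a : Fin p) : Set ℝ :=
  Set.Ioc (((a : ℕ) : ℝ) / (p : ℝ)) ((((a : ℕ) : ℝ) + 1) / (p : ℝ))

/-- The basic step graphon `e^p_(a,b)`: symmetrized indicator of `cell a × cell b`. -/
def ep (p : ℕ) (a b : Fin p) : Kern := fun x y =>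
  if (x ∈ cell p a ∧ y ∈ cell p b) ∨ (x ∈ cell p b ∧ y ∈ cell p a) then 1 else 0

/-- The step kernel with values `c a b` on the cell `cell a × cell b` (`a ≠ b`) and `0`
on the diagonal cells and outside `(0,1]²`. -/
def stepFn (p : ℕ) (c : Fin p → Fin p → ℝ) : Kern := fun x y =>
  ∑ a : Fin p, ∑ b : Fin p, if a ≠ b ∧ x ∈ cell p a ∧ y ∈ cell p b then c a b else 0

/-- The set `W_𝐩 = ⋃ₚ W_p` of step graphons. -/
def StepGraphons : Set Kern := {f | IsGraphon f ∧ ∃ p c, f = stepFn p c}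

/-- The union of the `S_[0,1]`-translates of `W_𝐩`. -/
def StepTranslates : Set Kern :=
  {f | ∃ σ : ℝ → ℝ, IsMPB σ ∧ ∃ g ∈ StepGraphons, f = Kern.translate σ g}

/-- Add `m` isolated vertices to a multigraph. -/
def MG.pad (G : MG) (m : ℕ) : MG where
  nv := G.nv + m
  ne := G.ne
  s := fun e => Fin.castAdd m (G.s e)
  t := fun e => Fin.castAdd m (G.t e)
  noLoop := fun e h => G.noLoop e (by
    apply Fin.ext
    simpa using congrArg Fin.val h)

/-- Two multigraphs become isomorphic after deleting isolated vertices (equivalently,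
after adding enough isolated vertices). -/
def StripEquiv (G H : MG) : Prop := ∃ a b : ℕ, MGIso (G.pad a) (H.pad b)

/-- A tuple of pairs of distinct indices in `Fin p` (encoding a tuple in `E_p^n`). -/
def ValidTuple (p n : ℕ) (x : Fin n → Fin p × Fin p) : Prop := ∀ l, (x l).1 ≠ (x l).2

/-- The multigraph `Γ_{n,p}(x)` associated to a tuple `x ∈ E_p^n`. -/
def tupleMG (p n : ℕ) (x : Fin n → Fin p × Fin p) (hx : ValidTuple p n x) : MG :=
  ⟨p, n, fun l => (x l).1, fun l => (x l).2, hx⟩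

/-- Symmetry of a functional on `W^n` under permutation of arguments. -/
def SymmFunc (n : ℕ) (Λ : (Fin n → Kern) → ℝ) : Prop :=
  ∀ (g : Fin n → Kern), (∀ i, g i ∈ Graphons) → ∀ τ : Equiv.Perm (Fin n),
    Λ (g ∘ τ) = Λ g

/-- `S_[0,1]`-invariance of a functional on `W^n`. -/
def SInvFunc (n : ℕ) (Λ : (Fin n → Kern) → ℝ) : Prop :=
  ∀ (g : Fin n → Kern), (∀ i, g i ∈ Graphons) → ∀ σ : ℝ → ℝ, IsMPB σ →
    Λ (fun i => Kern.translate σ (g i)) = Λ g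

/-- `π` is the consistency-constraint matrix `π_{n,k}`: it is invariant under
isomorphism-after-deleting-isolated-vertices in both arguments, and for every `p ≥ 2`,
every symmetric `S_[0,1]`-invariant multilinear functional `Λ : W^n → ℝ`, every
`x ∈ E_p^n` and every complete system `y` of pairwise non-isomorphic representatives
of the multigraphs with `n` edges on `kp` vertices, one has
`C_{n,p}(Λ)(Γ(x)) = Σ_h π(Γ(x)∼, h∼) C_{n,kp}(Λ)(h)`. -/
def ConsistencyMatrix (n k : ℕ) (π : MG → MG → ℕ) : Prop :=
  (∀ G G' H H', StripEquiv G G' → StripEquiv H H' → π G H = π G' H') ∧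
  ∀ p : ℕ, 2 ≤ p → ∀ Λ : (Fin n → Kern) → ℝ,
    SymmFunc n Λ → SInvFunc n Λ → MultilinearOnKerns n Λ →
    ∀ (x : Fin n → Fin p × Fin p) (hx : ValidTuple p n x),
    ∀ (m : ℕ) (y : Fin m → Fin n → Fin (k*p) × Fin (k*p))
      (hy : ∀ i, ValidTuple (k*p) n (y i)),
      (∀ i j, i ≠ j →
        ¬ MGIso (tupleMG (k*p) n (y i) (hy i)) (tupleMG (k*p) n (y j) (hy j))) →
      (∀ (z : Fin n → Fin (k*p) × Fin (k*p)) (hz : ValidTuple (k*p) n z),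
        ∃ i, MGIso (tupleMG (k*p) n z hz) (tupleMG (k*p) n (y i) (hy i))) →
      Λ (fun l => ep p (x l).1 (x l).2)
        = ∑ i : Fin m,
            (π (tupleMG p n x hx) (tupleMG (k*p) n (y i) (hy i)) : ℝ)
              * Λ (fun l => ep (k*p) (y i l).1 (y i l).2)

/-- Adjacency relation of a multigraph. -/
def MG.adj (G : MG) (u v : Fin G.nv) : Prop :=
  ∃ e, (G.s e = u ∧ G.t e = v) ∨ (G.s e = v ∧ G.t e = u)

/-- The homomorphism density of the simplification `G^simp` of a multigraph `G`
(replace each family of parallel edges by a single edge). -/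
def simpHomDensity (G : MG) (f : Kern) : ℝ :=
  ∫ x : Fin G.nv → ℝ,
    ∏ q ∈ Finset.univ.filter (fun q : Fin G.nv × Fin G.nv => q.1 < q.2 ∧ G.adj q.1 q.2),
      f (x q.1) (x q.2) ∂(Measure.pi fun _ => μ01)

/-- Tensor product of two kernels with respect to a fixed measure-preserving map
`φ : [0,1] → [0,1]²`. -/
def tensProd (φ : ℝ → ℝ × ℝ) (f g : Kern) : Kern :=
  fun x y => f (φ x).1 (φ y).1 * g (φ x).2 (φ y).2

/-- `m`-fold tensor power of a kernel. -/
def tensPow (φ : ℝ → ℝ × ℝ) (f : Kern) : ℕ → Kern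
  | 0 => fun _ _ => 1
  | 1 => f
  | (m+2) => tensProd φ f (tensPow φ f (m+1))

/-- A complete system of representatives for the isomorphism classes of multigraphs
with no isolated vertices. -/
def IsRepSet (R : Set MG) : Prop :=
  (∀ G ∈ R, NoIsolated G) ∧ ∀ G : MG, NoIsolated G → ∃! H, H ∈ R ∧ MGIso G H

/-- A `k`-labelled multigraph: a multigraph together with an injective labelling of `k`
distinguished vertices. -/
structure LMG (k : ℕ) where
  G : MG
  lab : Fin k → Fin G.nv
  inj : Function.Injective lab

/-- No unlabelled isolated vertices. -/
def LMG.NoUnlabIsolated {k : ℕ} (H : LMG k) : Prop :=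
  ∀ v, (∃ e, H.G.s e = v ∨ H.G.t e = v) ∨ ∃ a, H.lab a = v

/-- Assignment of coordinates to the vertices of a `k`-labelled multigraph: labelled
vertices get the fixed values `x`, unlabelled ones the integration variables `y`. -/
def LMG.assign {k : ℕ} (H : LMG k) (x : Fin k → ℝ) (y : Fin H.G.nv → ℝ) :
    Fin H.G.nv → ℝ :=
  fun v => if h : ∃ a, H.lab a = v then x h.choose else y v

/-- The partially labelled homomorphism density `t_𝐱(H, f)`. -/
def lhom {k : ℕ} (H : LMG k) (x : Fin k → ℝ) (f : Kern) : ℝ :=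
  ∫ y : Fin H.G.nv → ℝ,
    ∏ e : Fin H.G.ne, f (H.assign x y (H.G.s e)) (H.assign x y (H.G.t e))
    ∂(Measure.pi fun _ => μ01)

/-- The weighted partially labelled homomorphism density `t_𝐱(H, f; w)`. -/
def wlhom {k : ℕ} (H : LMG k) (x : Fin k → ℝ) (f : Kern)
    (w : (Fin H.G.nv → ℝ) → ℝ) : ℝ :=
  ∫ y : Fin H.G.nv → ℝ,
    w (H.assign x y) *
      ∏ e : Fin H.G.ne, f (H.assign x y (H.G.s e)) (H.assign x y (H.G.t e))
    ∂(Measure.pi fun _ => μ01)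

/-- The seminorm `‖w‖_{1,𝐱} = t_𝐱(H, 1, |w|)` of a weight. -/
def wnorm {k : ℕ} (H : LMG k) (x : Fin k → ℝ) (w : (Fin H.G.nv → ℝ) → ℝ) : ℝ :=
  ∫ y : Fin H.G.nv → ℝ, |w (H.assign x y)| ∂(Measure.pi fun _ => μ01)

/-- Label-respecting isomorphism of `k`-labelled multigraphs. -/
def LMGIso {k : ℕ} (H H' : LMG k) : Prop :=
  ∃ (φv : Fin H.G.nv ≃ Fin H'.G.nv) (φe : Fin H.G.ne ≃ Fin H'.G.ne),
    (∀ e, ({H'.G.s (φe e), H'.G.t (φe e)} : Finset (Fin H'.G.nv))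
        = {φv (H.G.s e), φv (H.G.t e)}) ∧
    ∀ a, φv (H.lab a) = H'.lab a

/-- A complete system of representatives for the label-respecting isomorphism classes
of `k`-labelled multigraphs with no unlabelled isolated vertices. -/
def IsLRepSet (k : ℕ) (R : Set (LMG k)) : Prop :=
  (∀ H ∈ R, H.NoUnlabIsolated) ∧
  ∀ H : LMG k, H.NoUnlabIsolated → ∃! H', H' ∈ R ∧ LMGIso H H'

end

lemma graphon_smul {f : Kern} (hf : IsGraphon f) {s : ℝ} (hs : s ∈ Set.Icc (0:ℝ) 1) :
    IsGraphon (s • f) := by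
  refine ⟨⟨?_, ?_⟩, ?_⟩
  · exact hf.1.1.const_smul s
  · intro x y
    simp [hf.1.2 x y]
  · intro x y
    have := hf.2 x y
    simp only [Pi.smul_apply, smul_eq_mul]
    exact ⟨mul_nonneg hs.1 this.1, mul_le_one₀ hs.2 this.1 this.2⟩

lemma graphon_between {f : Kern} {s r : ℝ} (hs : IsGraphon (s • f)) (hr : IsGraphon (r • f))
    {e : ℝ} (he : e ∈ Set.Icc (0:ℝ) 1) : IsGraphon ((s + e * (r - s)) • f) := by
  have h : (s + e * (r - s)) • f = (1 - e) • (s • f) + e • (r • f) := by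
    rw [smul_smul, smul_smul, ← add_smul]; congr 1; ring
  rw [h]
  refine ⟨⟨?_, ?_⟩, ?_⟩
  · exact (hs.1.1.const_smul (1 - e)).add (hr.1.1.const_smul e)
  · intro x y
    have h1 := hs.1.2 x y
    have h2 := hr.1.2 x y
    simp only [Pi.add_apply, Pi.smul_apply] at *
    rw [h1, h2]
  · intro x y
    have h1 := hs.2 x y
    have h2 := hr.2 x y
    simp only [Pi.add_apply, Pi.smul_apply, smul_eq_mul, Set.mem_Icc] at *
    obtain ⟨he0, he1⟩ := he
    constructor
    · have := mul_nonneg (sub_nonneg.2 he1) h1.1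
      have := mul_nonneg he0 h2.1
      linarith
    · have := mul_le_mul_of_nonneg_left h1.2 (sub_nonneg.2 he1)
      have := mul_le_mul_of_nonneg_left h2.2 he0
      linarith

lemma graphon_zero : IsGraphon (0 : Kern) := by
  refine ⟨⟨measurable_const, fun _ _ => rfl⟩, fun x y => by simp⟩

lemma graphon_adm_zero {f : Kern} (hf : IsGraphon f) : f ∈ adm Graphons (0 : Kern) := by
  refine ⟨1, one_pos, le_rfl, fun e h0 h1 => ?_⟩
  rw [zero_add]
  exact graphon_smul hf ⟨h0, h1.le⟩

lemma neBot_dir {f : Kern} (hf : IsGraphon f) {s : ℝ} (hs : IsGraphon (s • f)) :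
    (nhdsWithin (0:ℝ) {t : ℝ | t ≠ 0 ∧ s • f + t • f ∈ Graphons}).NeBot := by
  obtain ⟨r, hr, hrs⟩ : ∃ r : ℝ, IsGraphon (r • f) ∧ r ≠ s := by
    by_cases h : s = 0
    · exact ⟨1, by simpa using hf, by rw [h]; exact one_ne_zero⟩
    · exact ⟨0, by simpa using graphon_zero, fun h' => h h'.symm⟩
  have h1 : Tendsto (fun e : ℝ => e * (r - s)) (𝓝[>] 0)
      (nhdsWithin (0:ℝ) {t : ℝ | t ≠ 0 ∧ s • f + t • f ∈ Graphons}) := by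
    apply tendsto_nhdsWithin_of_tendsto_nhds_of_eventually_within
    · have : Tendsto (fun e : ℝ => e * (r - s)) (𝓝 0) (𝓝 (0 * (r - s))) :=
        (continuous_id.mul continuous_const).tendsto _
      rw [zero_mul] at this
      exact this.mono_left nhdsWithin_le_nhds
    · have h2 : ∀ᶠ e : ℝ in 𝓝[>] 0, e ∈ Set.Ioo (0:ℝ) 1 := Ioo_mem_nhdsGT one_pos
      filter_upwards [h2] with e he
      refine ⟨mul_ne_zero he.1.ne' (sub_ne_zero.2 hrs), ?_⟩
      rw [← add_smul]
      exact graphon_between hs hr ⟨he.1.le, he.2.le⟩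
  exact h1.neBot

lemma gD_line {n : ℕ} {F : Kern → ℝ} (hC : IsCn Graphons F (n + 1)) {f : Kern}
    (hf : IsGraphon f) :
    ∃ G : ℝ → ℝ, ContDiff ℝ ((n + 1 : ℕ) : WithTop ℕ∞) G ∧
      (∀ s : ℝ, IsGraphon (s • f) → G s = F (s • f)) ∧
      ∀ m ≤ n + 1, ∀ s : ℝ, IsGraphon (s • f) →
        gD Graphons F m (s • f) (fun _ => f) = iteratedDeriv m G s := by
  obtain ⟨G0, hG0, hG⟩ := hC 0 graphon_zero 1 (fun _ => f) (fun _ => graphon_adm_zero hf)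
  refine ⟨fun s => G0 (fun _ => s), ?_, ?_, ?_⟩
  · exact hG0.comp (contDiff_pi.2 fun _ => contDiff_id)
  · intro s hs
    have := hG (fun _ => s)
    simp only [Finset.univ_unique, Finset.sum_const, Finset.card_singleton, one_smul,
      zero_add] at this
    exact this hs
  · have hGc : ContDiff ℝ ((n + 1 : ℕ) : WithTop ℕ∞) (fun s : ℝ => G0 (fun _ => s)) :=
      hG0.comp (contDiff_pi.2 fun _ => contDiff_id)
    have hGe : ∀ s : ℝ, IsGraphon (s • f) → (fun s : ℝ => G0 (fun _ => s)) s = F (s • f) := by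
      intro s hs
      have := hG (fun _ => s)
      simp only [Finset.univ_unique, Finset.sum_const, Finset.card_singleton, one_smul,
        zero_add] at this
      exact this hs
    generalize (fun s : ℝ => G0 (fun _ => s)) = G at hGc hGe
    intro m
    induction m with
    | zero => intro _ s hs; simp [gD, hGe s hs]
    | succ m ih =>
      intro hm s hs
      have := neBot_dir hf hs
      apply Tendsto.limUnder_eq
      have hd : HasDerivAt (iteratedDeriv m G) (iteratedDeriv (m+1) G s) s := by
        have := (hGc.differentiable_iteratedDeriv m (by exact_mod_cast hm)).differentiableAt
          (x := s)
        rw [iteratedDeriv_succ]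
        exact this.hasDerivAt
      have ht := hd.tendsto_slope_zero
      have ht' := ht.mono_left (nhdsWithin_mono (0:ℝ)
        (s := {t : ℝ | t ≠ 0 ∧ s • f + t • f ∈ Graphons}) (fun t ht => ht.1))
      refine ht'.congr' ?_
      filter_upwards [self_mem_nhdsWithin] with t ht
      have h2 : IsGraphon ((s + t) • f) := by rw [add_smul]; exact ht.2
      have e1 := ih (by omega) (s + t) h2
      have e2 := ih (by omega) s hs
      rw [add_smul] at e1
      simp only [e1, e2, smul_eq_mul]
      ring

/-- The derivatives along a ray only depend on the restriction of `F` to it. -/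
lemma gD_eq_within {n : ℕ} {F : Kern → ℝ} (hC : IsCn Graphons F (n + 1)) {f : Kern}
    (hf : IsGraphon f) {m : ℕ} (hm : m ≤ n + 1) {s : ℝ} (hs : s ∈ Set.Icc (0:ℝ) 1) :
    gD Graphons F m (s • f) (fun _ => f)
      = iteratedDerivWithin m (fun t : ℝ => F (t • f)) (Set.Icc 0 1) s := by
  obtain ⟨G, hG, hGe, hGd⟩ := gD_line hC hf
  rw [hGd m hm s (graphon_smul hf hs)]
  have h1 : iteratedDerivWithin m (fun t : ℝ => F (t • f)) (Set.Icc 0 1) s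
      = iteratedDerivWithin m G (Set.Icc 0 1) s := by
    apply iteratedDerivWithin_congr
    · intro t ht
      exact (hGe t (graphon_smul hf ht)).symm
    · exact hs
  rw [h1]
  symm
  apply iteratedDerivWithin_eq_iteratedDeriv (uniqueDiffOn_Icc one_pos) _ hs
  exact (hG.of_le (by exact_mod_cast hm)).contDiffAt

lemma taylor_part {n : ℕ} {F : Kern → ℝ} (hC : IsCn Graphons F (n + 1)) {f : Kern}
    (hf : IsGraphon f) : ∃ c ∈ Set.Icc (0:ℝ) 1,
      F f - ∑ m ∈ Finset.range (n + 1),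
          (1 / (Nat.factorial m : ℝ)) * gD Graphons F m 0 (fun _ => f)
        = gD Graphons F (n + 1) (c • f) (fun _ => f) / (Nat.factorial (n + 1) : ℝ) := by
  obtain ⟨G, hG, hGe, hGd⟩ := gD_line hC hf
  have h1 : ContDiffOn ℝ ((n + 1 : ℕ) : WithTop ℕ∞) G (Set.uIcc 0 1) := hG.contDiffOn
  obtain ⟨c, hc, h⟩ := taylor_mean_remainder_lagrange_iteratedDeriv (n := n) (x₀ := (0:ℝ))
    (x := 1) zero_ne_one (by exact_mod_cast h1)
  rw [Set.uIoo_of_lt one_pos] at hc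
  rw [Set.uIcc_of_le zero_le_one] at h
  refine ⟨c, ⟨hc.1.le, hc.2.le⟩, ?_⟩
  rw [hGd (n+1) le_rfl c (graphon_smul hf ⟨hc.1.le, hc.2.le⟩)]
  have h2 : G 1 = F f := by
    have := hGe 1 (by simpa using hf)
    simpa using this
  rw [h2, taylor_within_apply] at h
  simp only [sub_zero, one_pow, mul_one, smul_eq_mul] at h
  rw [← h]
  congr 1
  apply Finset.sum_congr rfl
  intro m hm
  have hm' : m ≤ n + 1 := by simp at hm; omega
  have := hGd m hm' 0 (by simpa using graphon_zero)
  rw [zero_smul] at this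
  rw [this, one_div]
  rw [iteratedDerivWithin_eq_iteratedDeriv (uniqueDiffOn_Icc one_pos) _ (by simp)]
  exact (hG.of_le (by exact_mod_cast hm')).contDiffAt

/-- Non-loop unordered pairs in `Fin p`. -/
abbrev EI (p : ℕ) : Type := {z : Sym2 (Fin p) // ¬ z.IsDiag}

/-- The unordered pair of two distinct elements. -/
def edgeOf {p : ℕ} {a b : Fin p} (h : a ≠ b) : EI p := ⟨s(a, b), by simpa using h⟩

/-- A vertex map which does not collapse an edge. -/
def Proper (G : MG) {p : ℕ} (φ : Fin G.nv → Fin p) : Prop := ∀ e, φ (G.s e) ≠ φ (G.t e)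

/-- The image of `G` under `φ` has edge multiset `d`. -/
def IsReal (G : MG) {p : ℕ} (φ : Fin G.nv → Fin p) (d : EI p →₀ ℕ) : Prop :=
  ∃ h : Proper G φ, d = ∑ e, Finsupp.single (edgeOf (h e)) 1

/-- The action of permutations on pairs. -/
def permEI {p : ℕ} (σ : Equiv.Perm (Fin p)) (z : EI p) : EI p :=
  ⟨z.1.map σ, by
    rw [Sym2.isDiag_map σ.injective]; exact z.2⟩

/-- Variable of a pair, or zero on the diagonal. -/
noncomputable def XX (p : ℕ) (a b : Fin p) : MvPolynomial (EI p) ℝ :=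
  if h : a ≠ b then MvPolynomial.X (edgeOf h) else 0

/-- The homomorphism polynomial. -/
noncomputable def homPoly (p : ℕ) (G : MG) : MvPolynomial (EI p) ℝ :=
  ∑ φ : Fin G.nv → Fin p, ∏ e, XX p (φ (G.s e)) (φ (G.t e))

lemma IsReal.unique {G : MG} {p : ℕ} {φ : Fin G.nv → Fin p} {d d' : EI p →₀ ℕ}
    (h : IsReal G φ d) (h' : IsReal G φ d') : d = d' := by
  obtain ⟨_, h⟩ := h
  obtain ⟨_, h'⟩ := h'
  rw [h, h']

lemma homTerm_eq (p : ℕ) (G : MG) (φ : Fin G.nv → Fin p) (h : Proper G φ) :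
    ∏ e, XX p (φ (G.s e)) (φ (G.t e))
      = MvPolynomial.monomial (∑ e, Finsupp.single (edgeOf (h e)) 1) 1 := by
  rw [MvPolynomial.monomial_sum_one]
  apply Finset.prod_congr rfl
  intro e _
  rw [XX, dif_pos (h e)]
  rfl

lemma homTerm_eq_zero (p : ℕ) (G : MG) (φ : Fin G.nv → Fin p) (h : ¬ Proper G φ) :
    ∏ e, XX p (φ (G.s e)) (φ (G.t e)) = 0 := by
  simp only [Proper, not_forall] at h
  obtain ⟨e, he⟩ := h
  apply Finset.prod_eq_zero (Finset.mem_univ e)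
  rw [XX, dif_neg he]

lemma coeff_homPoly (p : ℕ) (G : MG) (d : EI p →₀ ℕ) :
    MvPolynomial.coeff d (homPoly p G)
      = ∑ φ : Fin G.nv → Fin p, if IsReal G φ d then (1:ℝ) else 0 := by
  rw [homPoly, MvPolynomial.coeff_sum]
  apply Finset.sum_congr rfl
  intro φ _
  by_cases h : Proper G φ
  · rw [homTerm_eq p G φ h, MvPolynomial.coeff_monomial]
    have : (∑ e, Finsupp.single (edgeOf (h e)) 1 = d) ↔ IsReal G φ d :=
      ⟨fun h' => ⟨h, h'.symm⟩, fun ⟨_, h'⟩ => h'.symm⟩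
    simp only [this]
  · rw [homTerm_eq_zero p G φ h, MvPolynomial.coeff_zero, if_neg]
    rintro ⟨h', _⟩
    exact h h'

lemma pair_finset_sym2 {α : Type*} [DecidableEq α] {a b c d : α} :
    ({a, b} : Finset α) = {c, d} ↔ s(a, b) = s(c, d) := by
  constructor
  · intro h
    have h1 : (({a, b} : Finset α) : Set α) = (({c, d} : Finset α) : Set α) := by rw [h]
    simp only [Finset.coe_insert, Finset.coe_singleton] at h1
    rw [Sym2.eq_iff]
    exact Set.pair_eq_pair_iff.1 h1
  · intro h
    rw [Sym2.eq_iff] at h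
    rcases h with ⟨rfl, rfl⟩ | ⟨rfl, rfl⟩
    · rfl
    · exact Finset.pair_comm _ _

lemma exists_perm_extend {k p : ℕ} (f g : Fin k → Fin p) (hf : Function.Injective f)
    (hg : Function.Injective g) : ∃ σ : Equiv.Perm (Fin p), ∀ i, σ (f i) = g i := by
  have := Equiv.Perm.isMultiplyPretransitive (Fin p) k
  obtain ⟨σ, h⟩ := this.exists_smul_eq ⟨f, hf⟩ ⟨g, hg⟩
  refine ⟨σ, fun i => ?_⟩
  have := congrArg (fun u : Fin k ↪ Fin p => u i) h
  simpa using this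

lemma edgeOf_eq_iff {p : ℕ} {a b c d : Fin p} (h : a ≠ b) (h' : c ≠ d) :
    edgeOf h = edgeOf h' ↔ s(a, b) = s(c, d) := by
  simp [edgeOf, Subtype.ext_iff]

lemma real_swap {p : ℕ} {G G' : MG} {φ : Fin G.nv → Fin p} {φ' : Fin G'.nv → Fin p}
    {d d' : EI p →₀ ℕ} (h : IsReal G φ d) (h' : IsReal G' φ' d') (hi : MGIso G G')
    (hφ : Function.Injective φ) (hφ' : Function.Injective φ') :
    ∃ σ : Equiv.Perm (Fin p), d' = d.mapDomain (permEI σ) := by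
  obtain ⟨⟨v, ee, hc⟩, hv, he⟩ := hi
  simp only at hv he
  obtain ⟨σ, hσ⟩ := exists_perm_extend φ (φ' ∘ v) hφ (hφ'.comp hv.1)
  refine ⟨σ, ?_⟩
  obtain ⟨hp, rfl⟩ := h
  obtain ⟨hp', rfl⟩ := h'
  rw [Finsupp.mapDomain_finsetSum, ← (Equiv.ofBijective ee he).sum_comp]
  apply Finset.sum_congr rfl
  intro e _
  rw [Finsupp.mapDomain_single]
  congr 1
  apply Subtype.ext
  have h1 := pair_finset_sym2.1 (hc e)
  have h2 := congrArg (Sym2.map φ') h1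
  simp only [Sym2.map_mk, Equiv.ofBijective_apply, edgeOf, permEI] at *
  rw [h2, hσ, hσ]
  rfl

lemma real_range {p : ℕ} {G : MG} {φ : Fin G.nv → Fin p} {d : EI p →₀ ℕ}
    (h : IsReal G φ d) (hn : NoIsolated G) (a : Fin p) :
    a ∈ Set.range φ ↔ ∃ z : EI p, d z ≠ 0 ∧ a ∈ z.1 := by
  obtain ⟨hp, rfl⟩ := h
  have key : ∀ z : EI p, (∑ e, Finsupp.single (edgeOf (hp e)) 1 : EI p →₀ ℕ) z ≠ 0 ↔
      ∃ e, edgeOf (hp e) = z := by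
    intro z
    rw [Finsupp.finsetSum_apply, Ne, Finset.sum_eq_zero_iff]
    simp [Finsupp.single_apply]
  simp only [key]
  constructor
  · rintro ⟨v, rfl⟩
    obtain ⟨e, he⟩ := hn v
    refine ⟨_, ⟨e, rfl⟩, ?_⟩
    rcases he with rfl | rfl <;> simp [edgeOf]
  · rintro ⟨_, ⟨e, rfl⟩, h⟩
    simp only [edgeOf, Sym2.mem_iff] at h
    rcases h with rfl | rfl <;> exact ⟨_, rfl⟩

lemma exists_equiv_of_sum_single {α β I : Type*} [Fintype α] [Fintype β] (f : α → I) (g : β → I)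
    (h : (∑ x, Finsupp.single (f x) 1 : I →₀ ℕ) = ∑ y, Finsupp.single (g y) 1) :
    ∃ τ : α ≃ β, ∀ x, g (τ x) = f x := by
  have h1 : ∀ i, Nonempty ({x // f x = i} ≃ {y // g y = i}) := by
    intro i
    have := DFunLike.congr_fun h i
    simp only [Finsupp.finsetSum_apply, Finsupp.single_apply, Finset.sum_boole] at this
    rw [← Fintype.card_eq, Fintype.card_subtype, Fintype.card_subtype]
    exact_mod_cast this
  have e : ∀ i, {x // f x = i} ≃ {y // g y = i} := fun i => (h1 i).some
  refine ⟨(Equiv.sigmaFiberEquiv f).symm.trans ((Equiv.sigmaCongrRight e).trans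
    (Equiv.sigmaFiberEquiv g)), fun x => ?_⟩
  exact (e (f x) ⟨x, rfl⟩).2

lemma real_cmp {p : ℕ} {G G' : MG} {ψ : Fin G.nv → Fin p} {φ' : Fin G'.nv → Fin p}
    {d : EI p →₀ ℕ} (h : IsReal G ψ d) (h' : IsReal G' φ' d) (hn : NoIsolated G)
    (hn' : NoIsolated G') (hφ' : Function.Injective φ') :
    G'.nv ≤ G.nv ∧ (G.nv ≤ G'.nv → MGIso G G') := by
  have hr : Set.range ψ = Set.range φ' := by
    ext a; rw [real_range h hn, real_range h' hn']
  have hmem : ∀ v, ∃ w, φ' w = ψ v := fun v => by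
    have : ψ v ∈ Set.range φ' := hr ▸ ⟨v, rfl⟩
    exact this
  have hmem' : ∀ w, ∃ v, ψ v = φ' w := fun v => by
    have : φ' v ∈ Set.range ψ := hr ▸ ⟨v, rfl⟩
    exact this
  choose v hv using hmem
  have hvs : Function.Surjective v := by
    intro w
    obtain ⟨u, hu⟩ := hmem' w
    exact ⟨u, hφ' (by rw [hv, hu])⟩
  have hle : G'.nv ≤ G.nv := by simpa using Fintype.card_le_of_surjective v hvs
  refine ⟨hle, fun hle' => ?_⟩
  have hvb : Function.Bijective v := by
    rw [Fintype.bijective_iff_surjective_and_card]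
    exact ⟨hvs, by simpa using le_antisymm hle' hle⟩
  obtain ⟨hp, h⟩ := h
  obtain ⟨hp', h'⟩ := h'
  obtain ⟨τ, hτ⟩ := exists_equiv_of_sum_single _ _ (h.symm.trans h')
  refine ⟨⟨v, τ, fun e => ?_⟩, hvb, τ.bijective⟩
  rw [pair_finset_sym2]
  apply Sym2.map.injective hφ'
  have := (edgeOf_eq_iff _ _).1 (hτ e)
  simp only [Sym2.map_mk, hv]
  exact this

lemma exists_real {p : ℕ} (d : EI p →₀ ℕ) :
    ∃ (G : MG) (φ : Fin G.nv → Fin p), NoIsolated G ∧ Function.Injective φ ∧ IsReal G φ d := by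
  obtain ⟨l, hl⟩ : ∃ l : List (EI p), (l.map fun z => (Finsupp.single z 1 : EI p →₀ ℕ)).sum = d := by
    induction d using Finsupp.induction_linear with
    | zero => exact ⟨[], rfl⟩
    | add f g hf hg =>
      obtain ⟨l, hl⟩ := hf
      obtain ⟨l', hl'⟩ := hg
      exact ⟨l ++ l', by simp [hl, hl']⟩
    | single a b => exact ⟨List.replicate b a, by simp⟩
  have hsum : ∑ i : Fin l.length, (Finsupp.single (l.get i) 1 : EI p →₀ ℕ) = d := by
    rw [← hl, ← Fin.sum_univ_fun_getElem]
    rfl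
  let S : Finset (Fin p) := Finset.univ.filter fun a => ∃ i, a ∈ (l.get i).1
  let ι := S.equivFin
  have hout : ∀ i, ∃ a b : Fin p, (l.get i).1 = s(a, b) := by
    intro i
    induction (l.get i).1 with
    | _ a b => exact ⟨a, b, rfl⟩
  choose sa ta hst using hout
  have hs : ∀ i, sa i ∈ S := fun i => by
    simp only [S, Finset.mem_filter, Finset.mem_univ, true_and]
    exact ⟨i, by rw [hst]; simp⟩
  have ht : ∀ i, ta i ∈ S := fun i => by
    simp only [S, Finset.mem_filter, Finset.mem_univ, true_and]
    exact ⟨i, by rw [hst]; simp⟩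
  have hne : ∀ i, sa i ≠ ta i := fun i h => (l.get i).2 (by rw [hst, h]; simp)
  refine ⟨⟨S.card, l.length, fun i => ι ⟨sa i, hs i⟩, fun i => ι ⟨ta i, ht i⟩, ?_⟩,
    fun v => (ι.symm v).1, ?_, ?_, ?_, ?_⟩
  · intro e h
    have := ι.injective h
    exact hne e (by simpa using this)
  · intro v
    have := (ι.symm v).2
    simp only [S, Finset.mem_filter, Finset.mem_univ, true_and] at this
    obtain ⟨i, hi⟩ := this
    refine ⟨i, ?_⟩
    rw [hst, Sym2.mem_iff] at hi
    rcases hi with hi | hi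
    · left
      simp only
      rw [← Equiv.eq_symm_apply]; exact Subtype.ext hi.symm
    · right
      simp only
      rw [← Equiv.eq_symm_apply]; exact Subtype.ext hi.symm
  · exact fun v w h => ι.symm.injective (Subtype.ext h)
  · intro e
    simpa using hne e
  · rw [← hsum]
    apply Finset.sum_congr rfl
    intro e _
    congr 1
    apply Subtype.ext
    simp [edgeOf]
    simpa using hst e

lemma nv_le (G : MG) (hn : NoIsolated G) : G.nv ≤ 2 * G.ne := by
  have : Function.Surjective (Sum.elim G.s G.t) := by
    intro v
    obtain ⟨e, he | he⟩ := hn v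
    · exact ⟨.inl e, he⟩
    · exact ⟨.inr e, he⟩
  have := Fintype.card_le_of_surjective _ this
  simp at this
  omega

lemma proper_of_inj {p : ℕ} {G : MG} {φ : Fin G.nv → Fin p} (h : Function.Injective φ) :
    Proper G φ := fun e h' => G.noLoop e (h h')

lemma exists_inj_real {p : ℕ} (G : MG) (hn : NoIsolated G) (hp : 2 * G.ne ≤ p) :
    ∃ (d : EI p →₀ ℕ) (φ : Fin G.nv → Fin p), Function.Injective φ ∧ IsReal G φ d := by
  have : G.nv ≤ p := (nv_le G hn).trans hp
  refine ⟨_, Fin.castLE this, Fin.castLE_injective this,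
    proper_of_inj (Fin.castLE_injective this), rfl⟩

lemma real_degree {p : ℕ} {G : MG} {φ : Fin G.nv → Fin p} {d : EI p →₀ ℕ}
    (h : IsReal G φ d) : d.degree = G.ne := by
  obtain ⟨hp, rfl⟩ := h
  simp [map_sum]

/-- Multigraphs with `m` edges and no isolated vertices. -/
abbrev GG (m : ℕ) : Type := {G : MG // G.ne = m ∧ NoIsolated G}

instance (m : ℕ) : Finite (GG m) := by
  let D : Type := {x : Σ nv : Fin (2 * m + 1), (Fin m → Fin nv) × (Fin m → Fin nv) //
    ∀ e, x.2.1 e ≠ x.2.2 e}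
  let f : D → MG := fun x => ⟨x.1.1, m, x.1.2.1, x.1.2.2, x.2⟩
  apply Set.Finite.to_subtype
  apply (Set.finite_range f).subset
  rintro ⟨nv, ne, s, t, h⟩ ⟨hm, hn⟩
  have hnv := nv_le _ hn
  simp only at hm hnv
  subst hm
  exact ⟨⟨⟨⟨nv, by omega⟩, s, t⟩, h⟩, rfl⟩

noncomputable instance (m : ℕ) : Fintype (GG m) := Fintype.ofFinite _

lemma MGIso.rfl' (G : MG) : MGIso G G :=
  ⟨⟨id, id, fun _ => rfl⟩, Function.bijective_id, Function.bijective_id⟩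

lemma MGIso.trans' {G H K : MG} (h1 : MGIso G H) (h2 : MGIso H K) : MGIso G K := by
  obtain ⟨⟨v, e, c⟩, hv, he⟩ := h1
  obtain ⟨⟨v', e', c'⟩, hv', he'⟩ := h2
  refine ⟨⟨v' ∘ v, e' ∘ e, fun x => ?_⟩, hv'.comp hv, he'.comp he⟩
  have h1 := pair_finset_sym2.1 (c x)
  have h2 := pair_finset_sym2.1 (c' (e x))
  rw [pair_finset_sym2]
  have h3 := congrArg (Sym2.map v') h1
  simp only [Sym2.map_mk] at h3
  exact h2.trans h3

lemma MGIso.symm' {G H : MG} (h1 : MGIso G H) : MGIso H G := by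
  obtain ⟨⟨v, e, c⟩, hv, he⟩ := h1
  let V := Equiv.ofBijective v hv
  let E := Equiv.ofBijective e he
  refine ⟨⟨V.symm, E.symm, fun x => ?_⟩, V.symm.bijective, E.symm.bijective⟩
  rw [pair_finset_sym2]
  apply Sym2.map.injective V.injective
  have h1 := pair_finset_sym2.1 (c (E.symm x))
  have h2 : e (E.symm x) = x := E.apply_symm_apply x
  rw [h2] at h1
  simp only [Sym2.map_mk, Equiv.apply_symm_apply]
  exact h1.symm

lemma MGIso.ne_eq {G H : MG} (h : MGIso G H) : G.ne = H.ne := by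
  obtain ⟨φ, _, he⟩ := h
  simpa using Fintype.card_of_bijective he

lemma MGIso.nv_eq {G H : MG} (h : MGIso G H) : G.nv = H.nv := by
  obtain ⟨φ, he, _⟩ := h
  simpa using Fintype.card_of_bijective he

lemma MGIso.noIsolated {G H : MG} (h : MGIso G H) (hG : NoIsolated G) : NoIsolated H := by
  obtain ⟨⟨v, e, c⟩, hv, he⟩ := h
  intro w
  obtain ⟨u, rfl⟩ := hv.2 w
  obtain ⟨x, hx⟩ := hG u
  refine ⟨e x, ?_⟩
  have h1 := pair_finset_sym2.1 (c x)
  have h2 : v u ∈ s(v (G.s x), v (G.t x)) := by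
    rcases hx with rfl | rfl <;> simp
  rw [← h1, Sym2.mem_iff] at h2
  rcases h2 with h2 | h2
  · exact Or.inl h2.symm
  · exact Or.inr h2.symm

instance ggSetoid (m : ℕ) : Setoid (GG m) where
  r G H := MGIso G.1 H.1
  iseqv := ⟨fun G => MGIso.rfl' G.1, fun h => h.symm', fun h h' => h.trans' h'⟩

/-- Isomorphism classes. -/
abbrev QQ (m : ℕ) : Type := Quotient (ggSetoid m)

noncomputable instance (m : ℕ) : Fintype (QQ m) := Fintype.ofFinite _

/-- The linear map from coefficients to polynomials. -/
noncomputable def TT (m p : ℕ) : (QQ m → ℝ) →ₗ[ℝ] MvPolynomial (EI p) ℝ where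
  toFun a := ∑ G : GG m, (a ⟦G⟧ * ((p:ℝ)⁻¹) ^ G.1.nv) • homPoly p G.1
  map_add' a b := by
    rw [← Finset.sum_add_distrib]
    apply Finset.sum_congr rfl
    intro G _
    rw [← add_smul]; congr 1; simp; ring
  map_smul' c a := by
    rw [Finset.smul_sum]
    apply Finset.sum_congr rfl
    intro G _
    rw [smul_smul]; congr 1; simp; ring

lemma coeff_TT (m p : ℕ) (a : QQ m → ℝ) (d : EI p →₀ ℕ) :
    MvPolynomial.coeff d (TT m p a)
      = ∑ G : GG m, (a ⟦G⟧ * ((p:ℝ)⁻¹) ^ G.1.nv) *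
          ∑ φ : Fin G.1.nv → Fin p, if IsReal G.1 φ d then (1:ℝ) else 0 := by
  simp [TT, MvPolynomial.coeff_sum, coeff_homPoly]

/-- Invariance under permutations of the vertices. -/
def PermInv {p : ℕ} (P : MvPolynomial (EI p) ℝ) : Prop :=
  ∀ (σ : Equiv.Perm (Fin p)) (d : EI p →₀ ℕ),
    MvPolynomial.coeff (d.mapDomain (permEI σ)) P = MvPolynomial.coeff d P

lemma permEI_symm {p : ℕ} (σ : Equiv.Perm (Fin p)) (z : EI p) :
    permEI σ.symm (permEI σ z) = z := by
  apply Subtype.ext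
  simp [permEI, Sym2.map_map]

lemma real_perm {p : ℕ} {G : MG} {φ : Fin G.nv → Fin p} {d : EI p →₀ ℕ}
    (σ : Equiv.Perm (Fin p)) (h : IsReal G φ d) :
    IsReal G (σ ∘ φ) (d.mapDomain (permEI σ)) := by
  obtain ⟨hp, rfl⟩ := h
  refine ⟨fun e h => hp e (σ.injective h), ?_⟩
  rw [Finsupp.mapDomain_finsetSum]
  apply Finset.sum_congr rfl
  intro e _
  rw [Finsupp.mapDomain_single]
  rfl

lemma permInv_TT (m p : ℕ) (a : QQ m → ℝ) : PermInv (TT m p a) := by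
  intro σ d
  rw [coeff_TT, coeff_TT]
  apply Finset.sum_congr rfl
  intro G _
  congr 1
  rw [← (Equiv.arrowCongr (Equiv.refl (Fin G.1.nv)) σ).sum_comp]
  apply Finset.sum_congr rfl
  intro φ _
  congr 1
  rw [eq_iff_iff]
  have e : (Equiv.arrowCongr (Equiv.refl (Fin G.1.nv)) σ) φ = σ ∘ φ := rfl
  rw [e]
  constructor
  · intro h
    have h1 := real_perm σ.symm h
    rw [← Finsupp.mapDomain_comp] at h1
    have e1 : permEI σ.symm ∘ permEI σ = id := funext (permEI_symm σ)
    have e2 : σ.symm ∘ σ ∘ φ = φ := by ext; simp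
    rwa [e1, e2, Finsupp.mapDomain_id] at h1
  · exact real_perm σ

lemma TT_injective (m p : ℕ) (hp : 2 * m ≤ p) : Function.Injective (TT m p) := by
  rw [injective_iff_map_eq_zero]
  intro a ha
  by_contra hne
  have hex : ∃ k, ∃ G : GG m, a ⟦G⟧ ≠ 0 ∧ k = 2 * m - G.1.nv := by
    by_contra hcon
    push Not at hcon
    apply hne
    ext q
    induction q using Quotient.inductionOn with
    | _ G =>
      by_contra h0
      exact hcon _ G h0 rfl
  obtain ⟨G', hG', hk⟩ := Nat.find_spec hex
  have hmax : ∀ G : GG m, a ⟦G⟧ ≠ 0 → G.1.nv ≤ G'.1.nv := by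
    intro G hG
    have h1 := Nat.find_min' hex ⟨G, hG, rfl⟩
    have h2 := nv_le G.1 G.2.2
    have h3 := nv_le G'.1 G'.2.2
    rw [G.2.1] at h2
    rw [G'.2.1] at h3
    omega
  obtain ⟨d, φ', hφ', hd⟩ := exists_inj_real (p := p) G'.1 G'.2.2 (by rw [G'.2.1]; exact hp)
  have hcoef := coeff_TT m p a d
  rw [ha, MvPolynomial.coeff_zero] at hcoef
  have hterm : ∀ G : GG m, (a ⟦G⟧ * ((p:ℝ)⁻¹) ^ G.1.nv) *
          (∑ φ : Fin G.1.nv → Fin p, if IsReal G.1 φ d then (1:ℝ) else 0)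
        = a ⟦G'⟧ * ((((p:ℝ)⁻¹) ^ G.1.nv) *
          (if a ⟦G⟧ = 0 then 0 else
            ∑ φ : Fin G.1.nv → Fin p, if IsReal G.1 φ d then (1:ℝ) else 0)) := by
    intro G
    by_cases h0 : a ⟦G⟧ = 0
    · simp [h0]
    by_cases hr : ∃ φ : Fin G.1.nv → Fin p, IsReal G.1 φ d
    · obtain ⟨φ, hφ⟩ := hr
      have := (real_cmp hφ hd G.2.2 G'.2.2 hφ').2 (hmax G h0)
      have : (⟦G⟧ : QQ m) = ⟦G'⟧ := Quotient.sound this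
      rw [if_neg h0, this]; ring
    · push Not at hr
      simp [hr]
  rw [Finset.sum_congr rfl (fun G _ => hterm G), ← Finset.mul_sum] at hcoef
  have hpos : 0 < ∑ G : GG m, ((((p:ℝ)⁻¹) ^ G.1.nv) *
          (if a ⟦G⟧ = 0 then 0 else
            ∑ φ : Fin G.1.nv → Fin p, if IsReal G.1 φ d then (1:ℝ) else 0)) := by
    apply Finset.sum_pos'
    · intro G _
      apply mul_nonneg (by positivity)
      split_ifs
      · exact le_rfl
      · apply Finset.sum_nonneg
        intro φ _
        split_ifs <;> norm_num
    · refine ⟨G', Finset.mem_univ _, ?_⟩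
      rw [if_neg hG']
      apply mul_pos
      · by_cases h0 : G'.1.nv = 0
        · rw [h0]; simp
        · have : 0 < p := (φ' ⟨0, Nat.pos_of_ne_zero h0⟩).pos
          positivity
      · apply Finset.sum_pos'
        · intro φ _
          split_ifs <;> norm_num
        · exact ⟨φ', Finset.mem_univ _, by rw [if_pos hd]; norm_num⟩
  rcases mul_eq_zero.1 hcoef.symm with h | h
  · exact hG' h
  · exact hpos.ne' h

lemma homPoly_homogeneous (p : ℕ) (G : MG) : (homPoly p G).IsHomogeneous G.ne := by
  apply MvPolynomial.IsHomogeneous.sum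
  intro φ _
  have := MvPolynomial.IsHomogeneous.prod Finset.univ
    (fun e => XX p (φ (G.s e)) (φ (G.t e))) (fun _ => 1) (by
      intro e _
      rw [XX]
      split_ifs
      · exact MvPolynomial.isHomogeneous_X _ _
      · exact MvPolynomial.isHomogeneous_zero _ _ _)
  simpa using this

lemma TT_homogeneous (m p : ℕ) (a : QQ m → ℝ) : (TT m p a).IsHomogeneous m := by
  apply MvPolynomial.IsHomogeneous.sum
  intro G _
  have h := homPoly_homogeneous p G.1
  rw [G.2.1] at h
  exact (MvPolynomial.homogeneousSubmodule (EI p) ℝ m).smul_mem _ h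

lemma TT_surj (m p : ℕ) (hp : 2 * m ≤ p) (P : MvPolynomial (EI p) ℝ) (hP : P.IsHomogeneous m)
    (hinv : PermInv P) : ∃ a : QQ m → ℝ, TT m p a = P := by
  have hex : ∀ q : QQ m, ∃ (d : EI p →₀ ℕ) (φ : Fin q.out.1.nv → Fin p),
      Function.Injective φ ∧ IsReal q.out.1 φ d := fun q =>
    exists_inj_real (p := p) q.out.1 q.out.2.2 (by rw [q.out.2.1]; exact hp)
  choose d φ hφ hd using hex
  let S : MvPolynomial (EI p) ℝ →ₗ[ℝ] (QQ m → ℝ) :=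
    LinearMap.pi fun q => MvPolynomial.lcoeff ℝ (d q)
  have hS : ∀ R : MvPolynomial (EI p) ℝ, R.IsHomogeneous m → PermInv R → S R = 0 → R = 0 := by
    intro R hR hRi hS0
    ext d'
    rw [MvPolynomial.coeff_zero]
    by_contra hne
    have hdeg : d'.degree = m := by
      by_contra h
      exact hne (hR.coeff_eq_zero h)
    obtain ⟨G, ψ, hn, hψ, hr⟩ := exists_real d'
    have hG : G.ne = m := (real_degree hr).symm.trans hdeg
    let q : QQ m := ⟦⟨G, hG, hn⟩⟧
    have hiso : MGIso q.out.1 G := Quotient.mk_out (s := ggSetoid m) ⟨G, hG, hn⟩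
    obtain ⟨σ, hσ⟩ := real_swap (hd q) hr hiso (hφ q) hψ
    have h0 : MvPolynomial.coeff (d q) R = 0 := congrFun hS0 q
    rw [hσ, hRi, h0] at hne
    exact hne rfl
  have hinj : Function.Injective (S ∘ₗ TT m p) := by
    rw [injective_iff_map_eq_zero]
    intro a ha
    have := hS _ (TT_homogeneous m p a) (permInv_TT m p a) ha
    exact TT_injective m p hp (by rw [this, map_zero])
  obtain ⟨a, ha⟩ := (LinearMap.injective_iff_surjective.1 hinj) (S P)
  refine ⟨a, ?_⟩
  rw [← sub_eq_zero]
  apply hS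
  · exact (MvPolynomial.homogeneousSubmodule (EI p) ℝ m).sub_mem (TT_homogeneous m p a) hP
  · intro σ d
    rw [MvPolynomial.coeff_sub, MvPolynomial.coeff_sub, permInv_TT m p a, hinv]
  · rw [map_sub, sub_eq_zero]; exact ha

lemma cell_unique {p : ℕ} {a b : Fin p} {x : ℝ} (ha : x ∈ cell p a) (hb : x ∈ cell p b) :
    a = b := by
  have hp : (0:ℝ) < p := by exact_mod_cast a.pos
  obtain ⟨h1, h2⟩ := ha
  obtain ⟨h3, h4⟩ := hb
  rw [div_lt_iff₀ hp] at h1 h3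
  rw [le_div_iff₀ hp] at h2 h4
  have e1 : ((a : ℕ) : ℝ) < (b : ℕ) + 1 := by linarith
  have e2 : ((b : ℕ) : ℝ) < (a : ℕ) + 1 := by linarith
  have e1' : (a : ℕ) < (b : ℕ) + 1 := by exact_mod_cast e1
  have e2' : (b : ℕ) < (a : ℕ) + 1 := by exact_mod_cast e2
  exact Fin.ext (by omega)

lemma exists_cell {p : ℕ} (hp : 0 < p) {x : ℝ} (hx : x ∈ Set.Ioc (0:ℝ) 1) :
    ∃ a : Fin p, x ∈ cell p a := by
  have hp' : (0:ℝ) < p := by exact_mod_cast hp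
  have h0 : 0 < x * p := mul_pos hx.1 hp'
  have h1 : 0 < ⌈x * p⌉₊ := Nat.ceil_pos.2 h0
  have h2 : ⌈x * p⌉₊ ≤ p := Nat.ceil_le.2 (by nlinarith [hx.2])
  refine ⟨⟨⌈x * p⌉₊ - 1, by omega⟩, ?_, ?_⟩
  · rw [div_lt_iff₀ hp']
    simp only [Nat.cast_sub h1, Nat.cast_one]
    have := Nat.ceil_lt_add_one h0.le
    linarith
  · rw [le_div_iff₀ hp']
    simp only [Nat.cast_sub h1, Nat.cast_one]
    have := Nat.le_ceil (x * p)
    linarith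

lemma cell_subset {p : ℕ} (a : Fin p) : cell p a ⊆ Set.Ioc 0 1 := by
  have hp : (0:ℝ) < p := by exact_mod_cast a.pos
  intro x hx
  obtain ⟨h1, h2⟩ := hx
  refine ⟨lt_of_le_of_lt (by positivity) h1, h2.trans ?_⟩
  rw [div_le_one hp]
  exact_mod_cast a.2

lemma measurableSet_cell {p : ℕ} (a : Fin p) : MeasurableSet (cell p a) := measurableSet_Ioc

lemma integral_cell {p : ℕ} (a : Fin p) :
    ∫ x, (cell p a).indicator (fun _ => (1:ℝ)) x ∂μ01 = (p:ℝ)⁻¹ := by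
  have hp : (0:ℝ) < p := by exact_mod_cast a.pos
  rw [integral_indicator (measurableSet_cell a), setIntegral_const, smul_eq_mul, mul_one,
    measureReal_def, Measure.restrict_apply (measurableSet_cell a),
    Set.inter_eq_left.2 ((cell_subset a).trans Set.Ioc_subset_Icc_self), cell, Real.volume_Ioc,
    ENNReal.toReal_ofReal]
  · field_simp; ring
  · rw [sub_nonneg]; gcongr; linarith

lemma stepFn_apply {p : ℕ} (c : Fin p → Fin p → ℝ) {a b : Fin p} {x y : ℝ}
    (hx : x ∈ cell p a) (hy : y ∈ cell p b) :
    stepFn p c x y = if a ≠ b then c a b else 0 := by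
  rw [stepFn, Finset.sum_eq_single a, Finset.sum_eq_single b]
  · simp [hx, hy]
  · intro b' _ hb'
    rw [if_neg]
    rintro ⟨_, _, h⟩
    exact hb' (cell_unique h hy)
  · simp
  · intro a' _ ha'
    apply Finset.sum_eq_zero
    intro b' _
    rw [if_neg]
    rintro ⟨_, h, _⟩
    exact ha' (cell_unique h hx)
  · simp

lemma stepFn_apply_out {p : ℕ} (c : Fin p → Fin p → ℝ) {x y : ℝ}
    (h : ¬ ((∃ a, x ∈ cell p a) ∧ ∃ b, y ∈ cell p b)) : stepFn p c x y = 0 := by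
  rw [stepFn]
  apply Finset.sum_eq_zero
  intro a _
  apply Finset.sum_eq_zero
  intro b _
  rw [if_neg]
  rintro ⟨_, h1, h2⟩
  exact h ⟨⟨a, h1⟩, ⟨b, h2⟩⟩

/-- Symmetric matrix with zero diagonal attached to weights on pairs. -/
noncomputable def cc {p : ℕ} (c : EI p → ℝ) (a b : Fin p) : ℝ :=
  if h : a ≠ b then c (edgeOf h) else 0

lemma cc_symm {p : ℕ} (c : EI p → ℝ) (a b : Fin p) : cc c a b = cc c b a := by
  by_cases h : a = b
  · rw [h]
  · rw [cc, cc, dif_pos h, dif_pos (Ne.symm h)]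
    congr 1
    rw [edgeOf_eq_iff]
    exact Sym2.eq_swap

lemma cc_diag {p : ℕ} (c : EI p → ℝ) (a : Fin p) : cc c a a = 0 := by simp [cc]

lemma eval_XX {p : ℕ} (c : EI p → ℝ) (a b : Fin p) :
    MvPolynomial.eval c (XX p a b) = cc c a b := by
  rw [XX, cc]
  split_ifs <;> simp

/-- The step kernel with given weights on pairs of cells. -/
noncomputable def stepK (p : ℕ) (c : EI p → ℝ) : Kern := stepFn p (cc c)

lemma stepK_apply {p : ℕ} (c : EI p → ℝ) {a b : Fin p} {x y : ℝ}
    (hx : x ∈ cell p a) (hy : y ∈ cell p b) : stepK p c x y = cc c a b := by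
  rw [stepK, stepFn_apply _ hx hy]
  split_ifs with h
  · rfl
  · rw [ne_eq, not_not] at h; rw [h, cc_diag]

lemma stepFn_measurable {p : ℕ} (c : Fin p → Fin p → ℝ) :
    Measurable (Function.uncurry (stepFn p c)) := by
  unfold stepFn Function.uncurry
  refine Finset.measurable_sum _ fun a _ => Finset.measurable_sum _ fun b _ => ?_
  apply Measurable.ite _ measurable_const measurable_const
  by_cases h : a = b
  · simp [h]
  · simp only [ne_eq, h, not_false_eq_true, true_and]
    exact ((measurableSet_cell a).preimage measurable_fst).inter
      ((measurableSet_cell b).preimage measurable_snd)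

lemma stepK_graphon {p : ℕ} {c : EI p → ℝ} (hc : ∀ z, c z ∈ Set.Icc (0:ℝ) 1) :
    IsGraphon (stepK p c) := by
  refine ⟨⟨stepFn_measurable _, ?_⟩, ?_⟩
  · intro x y
    by_cases h : (∃ a, x ∈ cell p a) ∧ ∃ b, y ∈ cell p b
    · obtain ⟨⟨a, ha⟩, ⟨b, hb⟩⟩ := h
      rw [stepK_apply c ha hb, stepK_apply c hb ha, cc_symm]
    · rw [stepK, stepFn_apply_out _ h, stepFn_apply_out]
      exact fun h' => h h'.symm
  · intro x y
    by_cases h : (∃ a, x ∈ cell p a) ∧ ∃ b, y ∈ cell p b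
    · obtain ⟨⟨a, ha⟩, ⟨b, hb⟩⟩ := h
      rw [stepK_apply c ha hb, cc]
      split_ifs
      · exact hc _
      · simp
    · rw [stepK, stepFn_apply_out _ h]
      simp

lemma ae_cell {k p : ℕ} (hp : 0 < p) :
    ∀ᵐ x ∂(Measure.pi fun _ : Fin k => μ01), ∃ φ : Fin k → Fin p, ∀ v, x v ∈ cell p (φ v) := by
  have h1 : ∀ᵐ t ∂μ01, t ∈ Set.Ioc (0:ℝ) 1 := by
    have : μ01 = volume.restrict (Set.Ioc (0:ℝ) 1) := restrict_Ioc_eq_restrict_Icc.symm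
    rw [this]
    exact ae_restrict_mem measurableSet_Ioc
  have h2 : ∀ v : Fin k, ∀ᵐ x ∂(Measure.pi fun _ : Fin k => μ01), x v ∈ Set.Ioc (0:ℝ) 1 := by
    intro v
    exact (Measure.quasiMeasurePreserving_eval (fun _ : Fin k => μ01) v).ae h1
  filter_upwards [ae_all_iff.2 h2] with x hx
  choose φ hφ using fun v => exists_cell hp (hx v)
  exact ⟨φ, hφ⟩

lemma homDensity_stepK {p : ℕ} (hp : 0 < p) (c : EI p → ℝ) (G : MG) :
    homDensity G (stepK p c)
      = ((p:ℝ)⁻¹) ^ G.nv * MvPolynomial.eval c (homPoly p G) := by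
  have h1 : homDensity G (stepK p c)
      = ∫ x : Fin G.nv → ℝ, ∑ φ : Fin G.nv → Fin p,
        (∏ e, cc c (φ (G.s e)) (φ (G.t e))) *
          ∏ v, (cell p (φ v)).indicator (fun _ => (1:ℝ)) (x v)
        ∂(Measure.pi fun _ => μ01) := by
    apply integral_congr_ae
    filter_upwards [ae_cell (k := G.nv) hp] with x hx
    obtain ⟨φ, hφ⟩ := hx
    rw [Finset.sum_eq_single φ]
    · have : ∏ v, (cell p (φ v)).indicator (fun _ => (1:ℝ)) (x v) = 1 := by
        apply Finset.prod_eq_one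
        intro v _
        exact Set.indicator_of_mem (hφ v) _
      rw [this, mul_one]
      apply Finset.prod_congr rfl
      intro e _
      exact stepK_apply c (hφ _) (hφ _)
    · intro ψ _ hψ
      obtain ⟨v, hv⟩ := Function.ne_iff.1 hψ
      have : (cell p (ψ v)).indicator (fun _ => (1:ℝ)) (x v) = 0 := by
        apply Set.indicator_of_notMem
        exact fun h => hv (cell_unique h (hφ v))
      rw [Finset.prod_eq_zero (Finset.mem_univ v) this, mul_zero]
    · simp
  rw [h1, integral_finsetSum]
  · rw [homPoly, map_sum, Finset.mul_sum]
    apply Finset.sum_congr rfl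
    intro φ _
    rw [integral_const_mul,
      integral_fintype_prod_eq_prod (fun v => (cell p (φ v)).indicator (fun _ => (1:ℝ)))]
    simp only [integral_cell, Finset.prod_const, Finset.card_univ, Fintype.card_fin, map_prod,
      eval_XX]
    ring
  · intro φ _
    apply Integrable.const_mul
    apply Integrable.fintype_prod (f := fun v => (cell p (φ v)).indicator (fun _ => (1:ℝ)))
    intro v
    exact (integrable_const _).indicator (measurableSet_cell _)

lemma eval_homPoly {p : ℕ} (c : EI p → ℝ) (G : MG) :
    MvPolynomial.eval c (homPoly p G)
      = ∑ φ : Fin G.nv → Fin p, ∏ e, cc c (φ (G.s e)) (φ (G.t e)) := by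
  simp [homPoly, eval_XX]

lemma cc_perm {p : ℕ} (c : EI p → ℝ) (σ : Equiv.Perm (Fin p)) (a b : Fin p) :
    cc (c ∘ permEI σ) a b = cc c (σ a) (σ b) := by
  by_cases h : a = b
  · rw [h, cc_diag, cc_diag]
  · have h' : σ a ≠ σ b := fun h' => h (σ.injective h')
    rw [cc, cc, dif_pos h, dif_pos h']
    rfl

lemma homDensity_perm {p : ℕ} (hp : 0 < p) (c : EI p → ℝ) (σ : Equiv.Perm (Fin p)) (G : MG) :
    homDensity G (stepK p (c ∘ permEI σ)) = homDensity G (stepK p c) := by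
  rw [homDensity_stepK hp, homDensity_stepK hp, eval_homPoly, eval_homPoly]
  congr 1
  symm
  rw [← (Equiv.arrowCongr (Equiv.refl (Fin G.nv)) σ).sum_comp]
  apply Finset.sum_congr rfl
  intro φ _
  simp [cc_perm, Equiv.arrowCongr]

/-- Refinement of weights. -/
noncomputable def refineC {p : ℕ} (N : ℕ) (c : EI p → ℝ) (z : EI (p * N)) : ℝ :=
  Sym2.lift ⟨fun a b : Fin (p * N) =>
    cc c (finProdFinEquiv.symm a).1 (finProdFinEquiv.symm b).1, fun _ _ => cc_symm _ _ _⟩ z.1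

lemma cc_refine {p N : ℕ} (c : EI p → ℝ) (a b : Fin (p * N)) :
    cc (refineC N c) a b = cc c (finProdFinEquiv.symm a).1 (finProdFinEquiv.symm b).1 := by
  by_cases h : a = b
  · rw [h, cc_diag, cc_diag]
  · rw [cc, dif_pos h]
    rfl

lemma refineC_mem {p N : ℕ} {c : EI p → ℝ} (hc : ∀ z, c z ∈ Set.Icc (0:ℝ) 1) (z : EI (p * N)) :
    refineC N c z ∈ Set.Icc (0:ℝ) 1 := by
  obtain ⟨z, hz⟩ := z
  induction z with
  | _ a b =>
    change cc c (finProdFinEquiv.symm a).1 (finProdFinEquiv.symm b).1 ∈ _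
    rw [cc]
    split_ifs
    · exact hc _
    · simp

lemma homDensity_refine {p N : ℕ} (hp : 0 < p) (hN : 0 < N) (c : EI p → ℝ) (G : MG) :
    homDensity G (stepK (p * N) (refineC N c)) = homDensity G (stepK p c) := by
  rw [homDensity_stepK hp, homDensity_stepK (Nat.mul_pos hp hN), eval_homPoly, eval_homPoly]
  simp only [cc_refine]
  rw [← (Equiv.arrowCongr (Equiv.refl (Fin G.nv)) (finProdFinEquiv (m := p) (n := N))).sum_comp]
  rw [← (Equiv.arrowProdEquivProdArrow (Fin G.nv) (fun _ => Fin p) (fun _ => Fin N)).symm.sum_comp]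
  rw [Fintype.sum_prod_type]
  have : ∀ (φ : Fin G.nv → Fin p) (ψ : Fin G.nv → Fin N),
    (∏ e, cc c (finProdFinEquiv.symm (((Equiv.refl (Fin G.nv)).arrowCongr finProdFinEquiv)
      ((Equiv.arrowProdEquivProdArrow (Fin G.nv) (fun _ => Fin p) (fun _ => Fin N)).symm (φ, ψ))
        (G.s e))).1 (finProdFinEquiv.symm (((Equiv.refl (Fin G.nv)).arrowCongr finProdFinEquiv)
      ((Equiv.arrowProdEquivProdArrow (Fin G.nv) (fun _ => Fin p) (fun _ => Fin N)).symm (φ, ψ))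
        (G.t e))).1) = ∏ e, cc c (φ (G.s e)) (φ (G.t e)) := by
    intro φ ψ
    simp [Equiv.arrowCongr, Equiv.arrowProdEquivProdArrow]
  simp only [this, Finset.sum_const, Finset.card_univ, Fintype.card_fun, Fintype.card_fin,
    nsmul_eq_mul]
  rw [← Finset.mul_sum]
  push_cast
  have hN' : (N:ℝ) ≠ 0 := by exact_mod_cast hN.ne'
  rw [← mul_assoc, mul_inv, mul_pow]
  congr 1
  rw [mul_assoc, ← mul_pow, inv_mul_cancel₀ hN', one_pow, mul_one]

lemma cc_sum {p : ℕ} (c : EI p → ℝ) (a b : Fin p) :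
    cc c a b = ∑ z, c z * cc (Pi.single z 1) a b := by
  by_cases h : a = b
  · rw [h, cc_diag]; simp [cc_diag]
  · simp only [cc, dif_pos (show a ≠ b from h)]
    simp [Pi.single_apply]

lemma stepK_sum {p : ℕ} (c : EI p → ℝ) :
    stepK p c = ∑ z, c z • stepK p (Pi.single z 1) := by
  funext x y
  simp only [Finset.sum_apply, Pi.smul_apply, smul_eq_mul]
  by_cases h : (∃ a, x ∈ cell p a) ∧ ∃ b, y ∈ cell p b
  · obtain ⟨⟨a, ha⟩, ⟨b, hb⟩⟩ := h
    simp only [stepK_apply _ ha hb]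
    exact cc_sum c a b
  · simp only [stepK, stepFn_apply_out _ h]
    simp

lemma stepK_smul {p : ℕ} (c : EI p → ℝ) (t : ℝ) : t • stepK p c = stepK p (t • c) := by
  rw [stepK_sum c, stepK_sum (t • c), Finset.smul_sum]
  apply Finset.sum_congr rfl
  intro z _
  rw [smul_smul]; rfl

lemma stepGraphon_exists {f : Kern} (hf : f ∈ StepGraphons) :
    ∃ p : ℕ, 0 < p ∧ ∃ c : EI p → ℝ, (∀ z, c z ∈ Set.Icc (0:ℝ) 1) ∧ f = stepK p c := by
  obtain ⟨hg, p, c, hpc⟩ := hf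
  rcases Nat.eq_zero_or_pos p with rfl | hp
  · refine ⟨1, one_pos, fun _ => 0, fun _ => by simp, ?_⟩
    rw [hpc]
    funext x y
    simp [stepK, stepFn, cc]
  · have hpt : ∀ a : Fin p, ∃ x, x ∈ cell p a := by
      intro a
      refine ⟨(((a : ℕ) : ℝ) + 1) / p, ?_, le_rfl⟩
      have hp' : (0:ℝ) < p := by exact_mod_cast hp
      gcongr
      linarith
    choose r hr using hpt
    refine ⟨p, hp, fun z => Sym2.lift ⟨fun a b => f (r a) (r b), fun a b => hg.1.2 _ _⟩ z.1,
      ?_, ?_⟩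
    · rintro ⟨z, hz⟩
      induction z with
      | _ a b => exact hg.2 _ _
    · funext x y
      by_cases h : (∃ a, x ∈ cell p a) ∧ ∃ b, y ∈ cell p b
      · obtain ⟨⟨a, ha⟩, ⟨b, hb⟩⟩ := h
        rw [stepK_apply _ ha hb, cc]
        split_ifs with hab
        · simp only [edgeOf, Sym2.lift_mk]
          rw [hpc, stepFn_apply _ ha hb, stepFn_apply _ (hr a) (hr b)]
        · rw [hpc, stepFn_apply _ ha hb, if_neg hab]
      · rw [stepK, stepFn_apply_out _ h, hpc, stepFn_apply_out _ h]

lemma stepK_mem {p : ℕ} {c : EI p → ℝ} (hc : ∀ z, c z ∈ Set.Icc (0:ℝ) 1) :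
    stepK p c ∈ StepTranslates := by
  refine ⟨id, ⟨MeasurePreserving.id _, Set.bijOn_id _⟩, stepK p c,
    ⟨stepK_graphon hc, p, cc c, rfl⟩, rfl⟩

lemma homDensity_smul (G : MG) (f : Kern) (t : ℝ) :
    homDensity G (t • f) = t ^ G.ne * homDensity G f := by
  rw [homDensity, homDensity, ← integral_const_mul]
  congr 1
  funext x
  simp [Finset.prod_mul_distrib]

lemma gD_eq_of_homDensity {n : ℕ} {F : Kern → ℝ} (hclass : IsClassFun F)
    (hC : IsCn Graphons F (n + 1)) {f g : Kern} (hf : IsGraphon f) (hg : IsGraphon g)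
    (h : ∀ G, homDensity G f = homDensity G g) {m : ℕ} (hm : m ≤ n + 1) :
    gD Graphons F m 0 (fun _ => f) = gD Graphons F m 0 (fun _ => g) := by
  have h1 := gD_eq_within hC hf hm (s := 0) (by simp)
  have h2 := gD_eq_within hC hg hm (s := 0) (by simp)
  rw [zero_smul] at h1 h2
  rw [h1, h2]
  apply iteratedDerivWithin_congr
  · intro t ht
    apply hclass _ _ (graphon_smul hf ht) (graphon_smul hg ht)
    intro G _
    rw [homDensity_smul, homDensity_smul, h]
  · simp

lemma iteratedDeriv_line {E : Type*} [NormedAddCommGroup E] [NormedSpace ℝ E] (G : E → ℝ)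
    {m : ℕ} (hG : ContDiff ℝ m G) (v : E) :
    iteratedDeriv m (fun t : ℝ => G (t • v)) 0 = iteratedFDeriv ℝ m G 0 (fun _ => v) := by
  have := ContinuousLinearMap.iteratedFDeriv_comp_right
    (ContinuousLinearMap.toSpanSingleton ℝ v) hG (0:ℝ) (i := m) le_rfl
  have e : (fun t : ℝ => G (t • v)) = G ∘ (ContinuousLinearMap.toSpanSingleton ℝ v) := by
    ext t; simp
  rw [iteratedDeriv_eq_iteratedFDeriv, e, this]
  simp

lemma exists_poly {n : ℕ} {F : Kern → ℝ} (hC : IsCn Graphons F (n + 1)) (p : ℕ) {m : ℕ}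
    (hm : m ≤ n + 1) : ∃ P : MvPolynomial (EI p) ℝ, P.IsHomogeneous m ∧
      ∀ c : EI p → ℝ, (∀ z, c z ∈ Set.Icc (0:ℝ) 1) →
        (1 / (Nat.factorial m : ℝ)) * gD Graphons F m 0 (fun _ => stepK p c)
          = MvPolynomial.eval c P := by
  let ι := (Fintype.equivFin (EI p)).symm
  obtain ⟨G, hGc, hG⟩ := hC 0 graphon_zero (Fintype.card (EI p))
    (fun i => stepK p (Pi.single (ι i) 1)) (by
      intro i
      apply graphon_adm_zero
      apply stepK_graphon
      intro z
      by_cases h : z = ι i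
      · rw [h]; simp
      · simp [Pi.single_eq_of_ne h])
  have hsum : ∀ c : EI p → ℝ, ∑ i, (c ∘ ι) i • stepK p (Pi.single (ι i) 1) = stepK p c := by
    intro c
    rw [stepK_sum c, ← ι.sum_comp]
    rfl
  have hGm : ContDiff ℝ (m : ℕ) G := hGc.of_le (by exact_mod_cast hm)
  let D := iteratedFDeriv ℝ m G 0
  refine ⟨∑ r : Fin m → Fin (Fintype.card (EI p)),
    MvPolynomial.C ((1 / (Nat.factorial m : ℝ)) * D (fun l => Pi.single (r l) 1)) *
      ∏ l, MvPolynomial.X (ι (r l)), ?_, ?_⟩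
  · apply MvPolynomial.IsHomogeneous.sum
    intro r _
    have h1 := MvPolynomial.IsHomogeneous.prod Finset.univ
      (fun l : Fin m => (MvPolynomial.X (ι (r l)) : MvPolynomial (EI p) ℝ)) (fun _ => 1)
      (fun l _ => MvPolynomial.isHomogeneous_X _ _)
    have h2 := (MvPolynomial.isHomogeneous_C (EI p)
      ((1 / (Nat.factorial m : ℝ)) * D (fun l => Pi.single (r l) 1))).mul h1
    simpa using h2
  · intro c hc
    have h1 := gD_eq_within hC (stepK_graphon hc) hm (s := 0) (by simp)
    rw [zero_smul] at h1
    have h2 : iteratedDerivWithin m (fun t : ℝ => F (t • stepK p c)) (Set.Icc 0 1) 0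
        = iteratedDerivWithin m (fun t : ℝ => G (t • (c ∘ ι))) (Set.Icc 0 1) 0 := by
      apply iteratedDerivWithin_congr
      · intro t ht
        have h3 := hG (t • (c ∘ ι))
        have h4 : ∑ i, (t • (c ∘ ι)) i • stepK p (Pi.single (ι i) 1) = t • stepK p c := by
          rw [stepK_smul, ← hsum (t • c)]
          rfl
        rw [h4, zero_add] at h3
        exact (h3 (graphon_smul (stepK_graphon hc) ht)).symm
      · simp
    have h5 : ContDiff ℝ (m : ℕ) (fun t : ℝ => G (t • (c ∘ ι))) :=
      hGm.comp (contDiff_id.smul contDiff_const)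
    rw [h1, h2, iteratedDerivWithin_eq_iteratedDeriv (uniqueDiffOn_Icc one_pos) h5.contDiffAt
      (by simp), iteratedDeriv_line G hGm]
    have h6 : (c ∘ ι) = ∑ i, (c (ι i)) • (Pi.single i 1 : Fin (Fintype.card (EI p)) → ℝ) := by
      ext j
      simp [Finset.sum_apply, Pi.single_apply]
    rw [h6]
    have h7 := D.toMultilinearMap.map_sum
      (fun (_ : Fin m) i => (c (ι i)) • (Pi.single i 1 : Fin (Fintype.card (EI p)) → ℝ))
    simp only [ContinuousMultilinearMap.coe_coe] at h7
    rw [h7, Finset.mul_sum, map_sum]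
    apply Finset.sum_congr rfl
    intro r _
    have h8 := D.toMultilinearMap.map_smul_univ (fun l => c (ι (r l)))
      (fun l => (Pi.single (r l) 1 : Fin (Fintype.card (EI p)) → ℝ))
    simp only [ContinuousMultilinearMap.coe_coe] at h8
    rw [h8]
    simp only [map_mul, MvPolynomial.eval_C, map_prod, MvPolynomial.eval_X, smul_eq_mul]
    ring

lemma poly_ext {p : ℕ} {P R : MvPolynomial (EI p) ℝ}
    (h : ∀ c : EI p → ℝ, (∀ z, c z ∈ Set.Icc (0:ℝ) 1) →
      MvPolynomial.eval c P = MvPolynomial.eval c R) : P = R := by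
  apply MvPolynomial.funext_set (fun _ => Set.Icc (0:ℝ) 1) (fun _ => Set.Icc_infinite one_pos)
  intro x hx
  exact h x (fun z => hx z (Set.mem_univ z))

lemma eval_TT {m p : ℕ} (hp : 0 < p) (a : QQ m → ℝ) (c : EI p → ℝ) :
    MvPolynomial.eval c (TT m p a) = ∑ G : GG m, a ⟦G⟧ * homDensity G.1 (stepK p c) := by
  simp only [TT, LinearMap.coe_mk, AddHom.coe_mk, map_sum, MvPolynomial.smul_eval]
  apply Finset.sum_congr rfl
  intro G _
  rw [homDensity_stepK hp]; ring

lemma permEI_injective {p : ℕ} (σ : Equiv.Perm (Fin p)) : Function.Injective (permEI σ) :=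
  Function.LeftInverse.injective (permEI_symm σ)

lemma exists_coeffs {n : ℕ} {F : Kern → ℝ} (hclass : IsClassFun F)
    (hC : IsCn Graphons F (n + 1)) {m : ℕ} (hm : m ≤ n + 1) :
    ∃ a : QQ m → ℝ, ∀ p : ℕ, 0 < p → ∀ c : EI p → ℝ, (∀ z, c z ∈ Set.Icc (0:ℝ) 1) →
        (1 / (Nat.factorial m : ℝ)) * gD Graphons F m 0 (fun _ => stepK p c)
          = ∑ G : GG m, a ⟦G⟧ * homDensity G.1 (stepK p c) := by
  have key : ∀ p : ℕ, 0 < p → 2 * m ≤ p → ∃ a : QQ m → ℝ,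
      ∀ c : EI p → ℝ, (∀ z, c z ∈ Set.Icc (0:ℝ) 1) →
        (1 / (Nat.factorial m : ℝ)) * gD Graphons F m 0 (fun _ => stepK p c)
          = ∑ G : GG m, a ⟦G⟧ * homDensity G.1 (stepK p c) := by
    intro p hp hmp
    obtain ⟨P, hPh, hP⟩ := exists_poly hC p hm
    have hinv : PermInv P := by
      intro σ d
      have hr : MvPolynomial.rename (permEI σ) P = P := by
        apply poly_ext
        intro c hc
        rw [MvPolynomial.eval_rename, ← hP c hc, ← hP (c ∘ permEI σ) (fun z => hc _)]
        rw [gD_eq_of_homDensity hclass hC (stepK_graphon (c := c ∘ permEI σ) (fun z => hc _))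
          (stepK_graphon hc)
          (homDensity_perm hp c σ) hm]
      have := MvPolynomial.coeff_rename_mapDomain (permEI σ) (permEI_injective σ) P d
      rwa [hr] at this
    obtain ⟨a, ha⟩ := TT_surj m p hmp P hPh hinv
    refine ⟨a, fun c hc => ?_⟩
    rw [hP c hc, ← ha, eval_TT hp]
  choose a ha using key
  have refine_eq : ∀ (p N : ℕ) (hp : 0 < p) (hN : 0 < N) (h2 : 2 * m ≤ p * N)
      (c : EI p → ℝ), (∀ z, c z ∈ Set.Icc (0:ℝ) 1) →
        (1 / (Nat.factorial m : ℝ)) * gD Graphons F m 0 (fun _ => stepK p c)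
          = ∑ G : GG m, a (p * N) (Nat.mul_pos hp hN) h2 ⟦G⟧ * homDensity G.1 (stepK p c) := by
    intro p N hp hN h2 c hc
    have h3 := ha (p * N) (Nat.mul_pos hp hN) h2 (refineC N c) (refineC_mem hc)
    rw [gD_eq_of_homDensity hclass hC (stepK_graphon (refineC_mem hc)) (stepK_graphon hc)
      (homDensity_refine hp hN c) hm] at h3
    rw [h3]
    simp only [homDensity_refine hp hN]
  have stable : ∀ (p N : ℕ) (hp : 0 < p) (hN : 0 < N) (h1 : 2 * m ≤ p) (h2 : 2 * m ≤ p * N),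
      a (p * N) (Nat.mul_pos hp hN) h2 = a p hp h1 := by
    intro p N hp hN h1 h2
    apply TT_injective m p h1
    apply poly_ext
    intro c hc
    rw [eval_TT hp, eval_TT hp, ← ha p hp h1 c hc, ← refine_eq p N hp hN h2 c hc]
  refine ⟨a (2 * m + 1) (by omega) (by omega), fun p hp c hc => ?_⟩
  have h2 : 2 * m ≤ p * (2 * m + 1) := by nlinarith
  have h3 := refine_eq p (2 * m + 1) hp (by omega) h2 c hc
  have h4 := stable (2 * m + 1) p (by omega) hp (by omega) (by nlinarith)
  have h5 : a (p * (2 * m + 1)) (Nat.mul_pos hp (by omega)) h2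
      = a ((2 * m + 1) * p) (Nat.mul_pos (by omega) hp) (by nlinarith) := by
    congr 1
    ring
  rw [h3, h5, h4]

lemma coeffs_unique {m : ℕ} {a b : QQ m → ℝ}
    (h : ∀ p : ℕ, 0 < p → ∀ c : EI p → ℝ, (∀ z, c z ∈ Set.Icc (0:ℝ) 1) →
      ∑ G : GG m, a ⟦G⟧ * homDensity G.1 (stepK p c)
        = ∑ G : GG m, b ⟦G⟧ * homDensity G.1 (stepK p c)) : a = b := by
  apply TT_injective m (2 * m + 1) (by omega)
  apply poly_ext
  intro c hc
  rw [eval_TT (by omega), eval_TT (by omega)]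
  exact h _ (by omega) c hc

lemma mu01_prob : IsProbabilityMeasure μ01 := ⟨by simp⟩

lemma translate_graphon {σ : ℝ → ℝ} (hσ : IsMPB σ) {g : Kern} (hg : IsGraphon g) :
    IsGraphon (Kern.translate σ g) := by
  refine ⟨⟨?_, fun x y => hg.1.2 _ _⟩, fun x y => hg.2 _ _⟩
  have hm := hσ.1.measurable
  exact hg.1.1.comp ((hm.comp measurable_fst).prodMk (hm.comp measurable_snd))

lemma homInt_measurable (G : MG) {f : Kern} (hf : IsGraphon f) :
    Measurable (fun x : Fin G.nv → ℝ => ∏ e : Fin G.ne, f (x (G.s e)) (x (G.t e))) := by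
  refine Finset.measurable_prod _ fun e _ => ?_
  have h : Measurable (fun x : Fin G.nv → ℝ => (x (G.s e), x (G.t e))) := by fun_prop
  exact hf.1.1.comp h

lemma translate_homDensity {σ : ℝ → ℝ} (hσ : IsMPB σ) {g : Kern} (hg : IsGraphon g) (G : MG) :
    homDensity G (Kern.translate σ g) = homDensity G g := by
  have := mu01_prob
  have h := MeasureTheory.measurePreserving_pi (fun _ : Fin G.nv => μ01) (fun _ => μ01)
    (fun _ => hσ.1)
  unfold homDensity
  conv_rhs => rw [← h.map_eq]
  rw [integral_map h.measurable.aemeasurable (homInt_measurable G hg).aestronglyMeasurable]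
  rfl

lemma prod_diff_le {ι : Type*} (s : Finset ι) (a b : ι → ℝ) (ha : ∀ i, a i ∈ Set.Icc (0:ℝ) 1)
    (hb : ∀ i, b i ∈ Set.Icc (0:ℝ) 1) :
    |∏ i ∈ s, a i - ∏ i ∈ s, b i| ≤ ∑ i ∈ s, |a i - b i| := by
  induction s using Finset.induction_on with
  | empty => simp
  | insert i s hi ih =>
    rw [Finset.prod_insert hi, Finset.prod_insert hi, Finset.sum_insert hi]
    have h1 : |∏ i ∈ s, a i| ≤ 1 := by
      rw [abs_of_nonneg (Finset.prod_nonneg fun i _ => (ha i).1)]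
      exact Finset.prod_le_one (fun i _ => (ha i).1) (fun i _ => (ha i).2)
    have h2 : |b i| ≤ 1 := by rw [abs_of_nonneg (hb i).1]; exact (hb i).2
    have e : a i * ∏ i ∈ s, a i - b i * ∏ i ∈ s, b i
        = (a i - b i) * ∏ i ∈ s, a i + b i * (∏ i ∈ s, a i - ∏ i ∈ s, b i) := by ring
    rw [e]
    refine (abs_add_le _ _).trans ?_
    rw [abs_mul, abs_mul]
    have h3 := mul_le_mul_of_nonneg_left h1 (abs_nonneg (a i - b i))
    have h4 := mul_le_mul_of_nonneg_right h2 (abs_nonneg (∏ i ∈ s, a i - ∏ i ∈ s, b i))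
    linarith

lemma pair_map {k : ℕ} {i j : Fin k} (hij : i ≠ j) :
    Measure.map (fun x : Fin k → ℝ => (x i, x j)) (Measure.pi fun _ => μ01) = μ01.prod μ01 := by
  have := mu01_prob
  have h := ProbabilityTheory.iIndepFun_pi (μ := fun _ : Fin k => μ01) (X := fun _ => id)
    (fun _ => aemeasurable_id)
  have h2 := h.indepFun hij
  simp only [id] at h2
  rw [ProbabilityTheory.indepFun_iff_map_prod_eq_prod_map_map
    (measurable_pi_apply i).aemeasurable (measurable_pi_apply j).aemeasurable] at h2
  rw [h2, (measurePreserving_eval (fun _ : Fin k => μ01) i).map_eq,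
    (measurePreserving_eval (fun _ : Fin k => μ01) j).map_eq]

lemma diff_meas {f g : Kern} (hf : IsGraphon f) (hg : IsGraphon g) :
    Measurable (fun z : ℝ × ℝ => |f z.1 z.2 - g z.1 z.2|) :=
  (hf.1.1.sub hg.1.1).abs

lemma diff_int {f g : Kern} (hf : IsGraphon f) (hg : IsGraphon g) :
    Integrable (fun z : ℝ × ℝ => |f z.1 z.2 - g z.1 z.2|) (μ01.prod μ01) := by
  have := mu01_prob
  refine Integrable.of_bound (diff_meas hf hg).aestronglyMeasurable 1 (ae_of_all _ fun z => ?_)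
  rw [Real.norm_eq_abs, abs_abs, abs_le]
  have h1 := hf.2 z.1 z.2
  have h2 := hg.2 z.1 z.2
  exact ⟨by linarith [h1.1, h2.2], by linarith [h1.2, h2.1]⟩

lemma l1Dist_eq {f g : Kern} (hf : IsGraphon f) (hg : IsGraphon g) :
    l1Dist f g = ∫ z, |f z.1 z.2 - g z.1 z.2| ∂(μ01.prod μ01) := by
  have := mu01_prob
  rw [integral_prod _ (diff_int hf hg)]
  rfl

lemma homDensity_lip (G : MG) {f g : Kern} (hf : IsGraphon f) (hg : IsGraphon g) :
    |homDensity G f - homDensity G g| ≤ G.ne * l1Dist f g := by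
  have := mu01_prob
  have hb : ∀ {f : Kern}, IsGraphon f →
      Integrable (fun x : Fin G.nv → ℝ => ∏ e : Fin G.ne, f (x (G.s e)) (x (G.t e)))
        (Measure.pi fun _ => μ01) := by
    intro f hf
    refine Integrable.of_bound (homInt_measurable G hf).aestronglyMeasurable 1
      (ae_of_all _ fun z => ?_)
    rw [Real.norm_eq_abs, abs_of_nonneg (Finset.prod_nonneg fun i _ => (hf.2 _ _).1)]
    exact Finset.prod_le_one (fun i _ => (hf.2 _ _).1) (fun i _ => (hf.2 _ _).2)
  have hpm : ∀ e : Fin G.ne, MeasurePreserving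
      (fun x : Fin G.nv → ℝ => (x (G.s e), x (G.t e))) (Measure.pi fun _ => μ01)
      (μ01.prod μ01) := fun e => ⟨by fun_prop, pair_map (G.noLoop e)⟩
  have hi : ∀ e : Fin G.ne, Integrable (fun x : Fin G.nv → ℝ =>
      |f (x (G.s e)) (x (G.t e)) - g (x (G.s e)) (x (G.t e))|) (Measure.pi fun _ => μ01) :=
    fun e => (hpm e).integrable_comp_of_integrable (diff_int hf hg)
  have hv : ∀ e : Fin G.ne, ∫ x : Fin G.nv → ℝ,
      |f (x (G.s e)) (x (G.t e)) - g (x (G.s e)) (x (G.t e))| ∂(Measure.pi fun _ => μ01)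
        = l1Dist f g := by
    intro e
    rw [l1Dist_eq hf hg, ← (hpm e).map_eq,
      integral_map (hpm e).measurable.aemeasurable (diff_meas hf hg).aestronglyMeasurable]
  unfold homDensity
  rw [← integral_sub (hb hf) (hb hg)]
  refine (abs_integral_le_integral_abs).trans ?_
  calc _ ≤ ∫ x : Fin G.nv → ℝ, ∑ e : Fin G.ne,
      |f (x (G.s e)) (x (G.t e)) - g (x (G.s e)) (x (G.t e))| ∂(Measure.pi fun _ => μ01) := by
        refine integral_mono ((hb hf).sub (hb hg)).abs (integrable_finsetSum _ fun e _ => hi e) ?_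
        intro x
        exact prod_diff_le _ _ _ (fun e => hf.2 _ _) (fun e => hg.2 _ _)
    _ = _ := by
        rw [integral_finsetSum _ (fun e _ => hi e)]
        simp [hv]

lemma finsum_GG {m : ℕ} {a : MG → ℝ} (f : Kern)
    (ha : ∀ G : MG, G.ne = m → ¬ NoIsolated G → a G = 0) :
    ∑ᶠ G ∈ {G : MG | G.ne = m}, a G * homDensity G f
      = ∑ G : GG m, a G.1 * homDensity G.1 f := by
  rw [← finsum_eq_sum_of_fintype]
  have h := finsum_set_coe_eq_finsum_mem (f := fun G => a G * homDensity G f)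
    {G : MG | G.ne = m ∧ NoIsolated G}
  refine Eq.trans ?_ h.symm
  apply finsum_mem_inter_support_eq'
  intro G hG
  constructor
  · intro h1
    refine ⟨h1, ?_⟩
    by_contra h2
    exact hG (by simp [ha G h1 h2])
  · exact fun h1 => h1.1

lemma GoodCoeffs.zero {n m : ℕ} {a : MG → ℝ} (ha : GoodCoeffs n a) :
    ∀ G : MG, G.ne = m → ¬ NoIsolated G → a G = 0 :=
  fun G _ h => ha.2 G fun h' => h h'.2

/-- The function on isomorphism classes induced by an iso-invariant family. -/
noncomputable def liftQ (m : ℕ) (a : MG → ℝ) (ha : IsoInvariant a) : QQ m → ℝ :=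
  Quotient.lift (fun G : GG m => a G.1) (fun G H h => ha G.1 H.1 h)

lemma liftQ_mk {m : ℕ} {a : MG → ℝ} (ha : IsoInvariant a) (G : GG m) :
    liftQ m a ha ⟦G⟧ = a G.1 := rfl

lemma exists_good {n : ℕ} {F : Kern → ℝ} (hclass : IsClassFun F)
    (hC : IsCn Graphons F (n + 1)) :
    ∃ a : MG → ℝ, GoodCoeffs n a ∧
      ∀ m : ℕ, m ≤ n → ∀ f ∈ StepTranslates,
        (1 / (Nat.factorial m : ℝ)) * gD Graphons F m 0 (fun _ => f)
          = ∑ᶠ G ∈ {G : MG | G.ne = m}, a G * homDensity G f := by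
  have hex := fun (m : ℕ) (hm : m ≤ n) =>
    exists_coeffs (m := m) hclass hC (hm.trans (Nat.le_succ n))
  choose a ha using hex
  let A : MG → ℝ := fun G =>
    if h : G.ne ≤ n ∧ NoIsolated G then a G.ne h.1 ⟦⟨G, rfl, h.2⟩⟧ else 0
  have hA : ∀ (k : ℕ) (hk : k ≤ n) (G : MG) (hG : G.ne = k) (hn : NoIsolated G),
      A G = a k hk ⟦⟨G, hG, hn⟩⟧ := by
    intro k hk G hG hn
    subst hG
    exact dif_pos ⟨hk, hn⟩
  have hgood : GoodCoeffs n A := by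
    constructor
    · intro G H h
      by_cases hG : G.ne ≤ n ∧ NoIsolated G
      · rw [hA G.ne hG.1 G rfl hG.2, hA G.ne hG.1 H h.ne_eq.symm (h.noIsolated hG.2)]
        congr 1
        exact Quotient.sound h
      · have hH : ¬ (H.ne ≤ n ∧ NoIsolated H) := by
          rintro ⟨h1, h2⟩
          exact hG ⟨h.ne_eq ▸ h1, h.symm'.noIsolated h2⟩
        have e1 : A G = 0 := dif_neg hG
        have e2 : A H = 0 := dif_neg hH
        rw [e1, e2]
    · intro G hG
      exact dif_neg hG
  refine ⟨A, hgood, ?_⟩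
  rintro m hm f ⟨σ, hσ, g, hg, rfl⟩
  rw [finsum_GG _ hgood.zero]
  obtain ⟨p, hp, c, hc, rfl⟩ := stepGraphon_exists hg
  have hgr := stepK_graphon hc
  rw [gD_eq_of_homDensity hclass hC (translate_graphon hσ hgr) hgr
    (fun G => translate_homDensity hσ hgr G) (hm.trans (Nat.le_succ n)), ha m hm p hp c hc]
  apply Finset.sum_congr rfl
  intro G _
  rw [translate_homDensity hσ hgr, hA m hm G.1 G.2.1 G.2.2]

lemma good_unique {n : ℕ} {F : Kern → ℝ} {a b : MG → ℝ} (ha : GoodCoeffs n a)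
    (hb : GoodCoeffs n b)
    (ha' : ∀ m : ℕ, m ≤ n → ∀ f ∈ StepTranslates,
        (1 / (Nat.factorial m : ℝ)) * gD Graphons F m 0 (fun _ => f)
          = ∑ᶠ G ∈ {G : MG | G.ne = m}, a G * homDensity G f)
    (hb' : ∀ m : ℕ, m ≤ n → ∀ f ∈ StepTranslates,
        (1 / (Nat.factorial m : ℝ)) * gD Graphons F m 0 (fun _ => f)
          = ∑ᶠ G ∈ {G : MG | G.ne = m}, b G * homDensity G f) : a = b := by
  funext G
  by_cases hG : G.ne ≤ n ∧ NoIsolated G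
  · have h : liftQ G.ne a ha.1 = liftQ G.ne b hb.1 := by
      apply coeffs_unique
      intro p hp c hc
      have h1 := ha' G.ne hG.1 _ (stepK_mem hc)
      have h2 := hb' G.ne hG.1 _ (stepK_mem hc)
      rw [finsum_GG _ ha.zero] at h1
      rw [finsum_GG _ hb.zero] at h2
      exact h1.symm.trans h2
    exact congrFun h ⟦⟨G, rfl, hG.2⟩⟧
  · rw [ha.2 G hG, hb.2 G hG]

lemma exists_symm_cont {f : Kern} (hf : IsGraphon f) {ε : ℝ} (hε : 0 < ε) :
    ∃ h : ℝ × ℝ → ℝ, Continuous h ∧ (∀ x y, h (x, y) = h (y, x)) ∧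
      (∀ z, h z ∈ Set.Icc (0:ℝ) 1) ∧
      ∫ z, |f z.1 z.2 - h z| ∂(μ01.prod μ01) ≤ ε := by
  have := mu01_prob
  have hfi : Integrable (Function.uncurry f) (μ01.prod μ01) := by
    refine Integrable.of_bound hf.1.1.aestronglyMeasurable 1 (ae_of_all _ fun z => ?_)
    show |f z.1 z.2| ≤ 1
    rw [abs_of_nonneg (hf.2 _ _).1]
    exact (hf.2 _ _).2
  obtain ⟨h, _, hle, hc, hhi⟩ := hfi.exists_hasCompactSupport_integral_sub_le hε
  have hI : Integrable (fun z => |f z.1 z.2 - h z|) (μ01.prod μ01) := (hfi.sub hhi).abs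
  have hI2 : Integrable (fun z : ℝ × ℝ => |f z.2 z.1 - h z.swap|) (μ01.prod μ01) := hI.swap
  have hE : ∫ z : ℝ × ℝ, |f z.2 z.1 - h z.swap| ∂(μ01.prod μ01)
      = ∫ z, |f z.1 z.2 - h z| ∂(μ01.prod μ01) :=
    integral_prod_swap (fun z : ℝ × ℝ => |f z.1 z.2 - h z|)
  have hle' : ∫ z, |f z.1 z.2 - h z| ∂(μ01.prod μ01) ≤ ε := hle
  refine ⟨fun z => max 0 (min 1 ((h z + h z.swap) / 2)), by fun_prop, ?_, ?_, ?_⟩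
  · intro x y
    simp [add_comm]
  · intro z
    exact ⟨le_max_left _ _, max_le zero_le_one (min_le_left _ _)⟩
  · calc _ ≤ ∫ z : ℝ × ℝ, (|f z.1 z.2 - h z| + |f z.2 z.1 - h z.swap|) / 2 ∂(μ01.prod μ01) := by
          refine integral_mono_of_nonneg (ae_of_all _ fun z => abs_nonneg _)
            ((hI.add hI2).div_const 2) (ae_of_all _ fun z => ?_)
          have h1 := hf.2 z.1 z.2
          have h3 := hf.1.2 z.1 z.2
          have e1 : |f z.1 z.2 - max 0 (min 1 ((h z + h z.swap) / 2))|
              ≤ |f z.1 z.2 - (h z + h z.swap) / 2| := by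
            rcases le_total ((h z + h z.swap) / 2) 1 with h4 | h4
            · rw [min_eq_right h4]
              rcases le_total 0 ((h z + h z.swap) / 2) with h5 | h5
              · rw [max_eq_right h5]
              · rw [max_eq_left h5, abs_of_nonneg (by linarith [h1.1]),
                  abs_of_nonneg (by linarith [h1.1])]
                linarith
            · rw [min_eq_left h4, max_eq_right zero_le_one, abs_of_nonpos (by linarith [h1.2]),
                abs_of_nonpos (by linarith [h1.2])]
              linarith
          refine e1.trans ?_
          have e2 : f z.1 z.2 - (h z + h z.swap) / 2
              = ((f z.1 z.2 - h z) + (f z.2 z.1 - h z.swap)) / 2 := by rw [← h3]; ring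
          rw [e2, abs_div, abs_two]
          have := abs_add_le (f z.1 z.2 - h z) (f z.2 z.1 - h z.swap)
          linarith
    _ ≤ ε := by
          rw [integral_div, integral_add hI hI2, hE]
          linarith

lemma exists_step_close {f : Kern} (hf : IsGraphon f) {δ : ℝ} (hδ : 0 < δ) :
    ∃ p : ℕ, 0 < p ∧ ∃ c : EI p → ℝ, (∀ z, c z ∈ Set.Icc (0:ℝ) 1) ∧
      l1Dist f (stepK p c) < δ := by
  have := mu01_prob
  obtain ⟨h, hc, hs, hr, hle⟩ := exists_symm_cont hf (ε := δ / 4) (by linarith)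
  have hK : IsCompact (Set.Icc (0:ℝ) 1 ×ˢ Set.Icc (0:ℝ) 1) := isCompact_Icc.prod isCompact_Icc
  have huc := hK.uniformContinuousOn_of_continuous hc.continuousOn
  rw [Metric.uniformContinuousOn_iff] at huc
  obtain ⟨η, hη, hu⟩ := huc (δ / 4) (by linarith)
  obtain ⟨q, hq⟩ := exists_nat_gt (max (η⁻¹) (4 / δ))
  have hq0 : (0:ℝ) < q := lt_of_lt_of_le (by positivity) ((le_max_right _ _).trans hq.le)
  have hqη : (q:ℝ)⁻¹ < η := by
    rw [inv_lt_comm₀ hq0 hη]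
    exact (le_max_left _ _).trans_lt hq
  have hqδ : (q:ℝ)⁻¹ < δ / 4 := by
    rw [inv_lt_comm₀ hq0 (by linarith), inv_div]
    exact (le_max_right _ _).trans_lt hq
  have hqp : 0 < q := by exact_mod_cast hq0
  let v : Fin q → ℝ := fun a => (((a : ℕ) : ℝ) + 1) / (q : ℝ)
  let k : Sym2 (Fin q) → ℝ := Sym2.lift ⟨fun a b => h (v a, v b), fun a b => hs _ _⟩
  let c : EI q → ℝ := fun z => k z.1
  have hcr : ∀ z, c z ∈ Set.Icc (0:ℝ) 1 := by
    rintro ⟨z, hz⟩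
    induction z using Sym2.ind with
    | _ a b => exact hr _
  have hcc : ∀ a b, a ≠ b → cc c a b = h (v a, v b) := by
    intro a b hab
    rw [cc, dif_pos hab]
    rfl
  have hv : ∀ a, v a ∈ cell q a := by
    intro a
    refine ⟨?_, le_rfl⟩
    show _ / _ < _ / _
    gcongr
    linarith
  have hdist : ∀ a x, x ∈ cell q a → dist x (v a) < η := by
    intro a x hx
    refine lt_of_le_of_lt ?_ hqη
    rw [Real.dist_eq, abs_of_nonpos (by linarith [hx.2])]
    have h1 := hx.1
    have e : v a = ((a : ℕ) : ℝ) / q + (q:ℝ)⁻¹ := by simp only [v]; field_simp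
    linarith
  have hcI : ∀ a x, x ∈ cell q a → x ∈ Set.Icc (0:ℝ) 1 :=
    fun a x hx => Set.Ioc_subset_Icc_self (cell_subset a hx)
  have hgr := stepK_graphon hcr
  refine ⟨q, hqp, c, hcr, ?_⟩
  let D : ℝ × ℝ → ℝ := fun z => ∑ a : Fin q, (cell q a).indicator (fun _ => (1:ℝ)) z.1 *
    (cell q a).indicator (fun _ => (1:ℝ)) z.2
  have hci : ∀ a : Fin q, Integrable ((cell q a).indicator (fun _ => (1:ℝ))) μ01 := fun a =>
    (integrable_const _).indicator (measurableSet_cell a)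
  have hDa : ∀ a : Fin q, Integrable (fun z : ℝ × ℝ => (cell q a).indicator (fun _ => (1:ℝ)) z.1 *
    (cell q a).indicator (fun _ => (1:ℝ)) z.2) (μ01.prod μ01) := fun a => (hci a).mul_prod (hci a)
  have hDi : Integrable D (μ01.prod μ01) := integrable_finsetSum _ fun a _ => hDa a
  have hDv : ∫ z, D z ∂(μ01.prod μ01) = (q:ℝ)⁻¹ := by
    simp only [D]
    rw [integral_finsetSum _ fun a _ => hDa a]
    simp only [integral_prod_mul, integral_cell, Finset.sum_const, Finset.card_univ,
      Fintype.card_fin, nsmul_eq_mul]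
    field_simp
  have hD0 : ∀ z, 0 ≤ D z := fun z => Finset.sum_nonneg fun a _ =>
    mul_nonneg (Set.indicator_nonneg (fun _ _ => zero_le_one) _)
      (Set.indicator_nonneg (fun _ _ => zero_le_one) _)
  have hfh : Integrable (fun z : ℝ × ℝ => |f z.1 z.2 - h z|) (μ01.prod μ01) := by
    have hm : Measurable (fun z : ℝ × ℝ => |f z.1 z.2 - h z|) := (hf.1.1.sub hc.measurable).abs
    refine Integrable.of_bound hm.aestronglyMeasurable 1 (ae_of_all _ fun z => ?_)
    rw [Real.norm_eq_abs, abs_abs, abs_le]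
    have h1 := hf.2 z.1 z.2
    have h2 := hr z
    exact ⟨by linarith [h1.1, h2.2], by linarith [h1.2, h2.1]⟩
  have h01 : ∀ᵐ t ∂μ01, t ∈ Set.Ioc (0:ℝ) 1 := by
    have : μ01 = volume.restrict (Set.Ioc (0:ℝ) 1) := restrict_Ioc_eq_restrict_Icc.symm
    rw [this]
    exact ae_restrict_mem measurableSet_Ioc
  have hx1 : ∀ᵐ z ∂(μ01.prod μ01), z.1 ∈ Set.Ioc (0:ℝ) 1 :=
    Measure.quasiMeasurePreserving_fst.ae h01
  have hx2 : ∀ᵐ z ∂(μ01.prod μ01), z.2 ∈ Set.Ioc (0:ℝ) 1 :=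
    Measure.quasiMeasurePreserving_snd.ae h01
  rw [l1Dist_eq hf hgr]
  calc _ ≤ ∫ z : ℝ × ℝ, (|f z.1 z.2 - h z| + (δ / 4 + D z)) ∂(μ01.prod μ01) := by
        refine integral_mono_ae (diff_int hf hgr) (hfh.add ((integrable_const _).add hDi)) ?_
        filter_upwards [hx1, hx2] with z hz1 hz2
        obtain ⟨a, ha⟩ := exists_cell hqp hz1
        obtain ⟨b, hb⟩ := exists_cell hqp hz2
        have key : |h z - stepK q c z.1 z.2| ≤ δ / 4 + D z := by
          rw [stepK_apply c ha hb]
          by_cases hab : a = b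
          · subst hab
            rw [cc_diag, sub_zero, abs_of_nonneg (hr z).1]
            have h2 : (1:ℝ) ≤ D z := by
              have h3 := Finset.single_le_sum
                (f := fun a : Fin q => (cell q a).indicator (fun _ => (1:ℝ)) z.1 *
                  (cell q a).indicator (fun _ => (1:ℝ)) z.2)
                (fun a _ => mul_nonneg (Set.indicator_nonneg (fun _ _ => zero_le_one) _)
                  (Set.indicator_nonneg (fun _ _ => zero_le_one) _)) (Finset.mem_univ a)
              simp only [Set.indicator_of_mem ha, Set.indicator_of_mem hb, mul_one] at h3
              exact h3
            linarith [(hr z).2]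
          · rw [hcc a b hab]
            have h3 := hu z ⟨hcI a _ ha, hcI b _ hb⟩ (v a, v b)
              ⟨hcI a _ (hv a), hcI b _ (hv b)⟩
              (by rw [Prod.dist_eq]; exact max_lt (hdist a _ ha) (hdist b _ hb))
            rw [Real.dist_eq] at h3
            linarith [hD0 z]
        have h4 := abs_sub_le (f z.1 z.2) (h z) (stepK q c z.1 z.2)
        show _ ≤ |f z.1 z.2 - h z| + (δ / 4 + D z)
        linarith
    _ = ∫ z, |f z.1 z.2 - h z| ∂(μ01.prod μ01) + (δ / 4 + (q:ℝ)⁻¹) := by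
        have hE : Integrable (fun z => δ / 4 + D z) (μ01.prod μ01) := (integrable_const _).add hDi
        rw [integral_add hfh hE,
          integral_add (integrable_const _) hDi, hDv]
        simp
    _ < δ := by linarith

lemma good_extend {n : ℕ} {F : Kern → ℝ} {a : MG → ℝ} (ha : GoodCoeffs n a)
    (ha' : ∀ m : ℕ, m ≤ n → ∀ f ∈ StepTranslates,
        (1 / (Nat.factorial m : ℝ)) * gD Graphons F m 0 (fun _ => f)
          = ∑ᶠ G ∈ {G : MG | G.ne = m}, a G * homDensity G f)
    {m : ℕ} (hm : m ≤ n) (hL : L1ContOn (fun f => gD Graphons F m 0 (fun _ => f)))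
    {f : Kern} (hf : IsGraphon f) :
    (1 / (Nat.factorial m : ℝ)) * gD Graphons F m 0 (fun _ => f)
          = ∑ᶠ G ∈ {G : MG | G.ne = m}, a G * homDensity G f := by
  rw [finsum_GG _ ha.zero]
  set S : ℝ := ∑ G : GG m, |a G.1| * (G.1.ne : ℝ) with hS
  have hS0 : 0 ≤ S := Finset.sum_nonneg fun G _ => by positivity
  rw [← sub_eq_zero]
  rw [← abs_nonpos_iff]
  refine le_of_forall_pos_le_add fun ε hε => ?_
  obtain ⟨δ, hδ, hcont⟩ := hL f hf (ε / 2) (by linarith)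
  have hδ' : 0 < min δ (ε / (2 * (S + 1))) := lt_min hδ (by positivity)
  obtain ⟨p, hp, c, hc, hclose⟩ := exists_step_close hf hδ'
  have hgr := stepK_graphon hc
  have h1 := hcont _ hgr (hclose.trans_le (min_le_left _ _))
  have h2 := ha' m hm _ (stepK_mem hc)
  rw [finsum_GG _ ha.zero] at h2
  have hd0 : 0 ≤ l1Dist f (stepK p c) := by
    rw [l1Dist_eq hf hgr]
    exact integral_nonneg fun _ => abs_nonneg _
  have h3 : |∑ G : GG m, a G.1 * homDensity G.1 f
      - ∑ G : GG m, a G.1 * homDensity G.1 (stepK p c)| ≤ ε / 2 := by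
    rw [← Finset.sum_sub_distrib]
    calc _ ≤ ∑ G : GG m, |a G.1 * homDensity G.1 f - a G.1 * homDensity G.1 (stepK p c)| :=
          Finset.abs_sum_le_sum_abs _ _
      _ ≤ ∑ G : GG m, |a G.1| * (G.1.ne : ℝ) * l1Dist f (stepK p c) := by
          refine Finset.sum_le_sum fun G _ => ?_
          rw [← mul_sub, abs_mul, mul_assoc]
          exact mul_le_mul_of_nonneg_left (homDensity_lip _ hf hgr) (abs_nonneg _)
      _ = S * l1Dist f (stepK p c) := by rw [hS, Finset.sum_mul]
      _ ≤ (S + 1) * (ε / (2 * (S + 1))) := by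
          refine mul_le_mul (by linarith) (hclose.le.trans (min_le_right _ _)) hd0 (by linarith)
      _ = ε / 2 := by field_simp
  have h4 : |(1 / (Nat.factorial m : ℝ)) * gD Graphons F m 0 (fun _ => f)
      - (1 / (Nat.factorial m : ℝ)) * gD Graphons F m 0 (fun _ => stepK p c)| ≤ ε / 2 := by
    rw [← mul_sub, abs_mul]
    have hfac : |1 / (Nat.factorial m : ℝ)| ≤ 1 := by
      rw [abs_of_nonneg (by positivity), div_le_one (by positivity)]
      exact_mod_cast Nat.one_le_iff_ne_zero.2 (Nat.factorial_ne_zero m)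
    have := mul_le_mul hfac h1.le (abs_nonneg _) zero_le_one
    linarith
  rw [h2] at h4
  rw [abs_sub_comm] at h3
  have h5 := abs_sub_le ((1 / (Nat.factorial m : ℝ)) * gD Graphons F m 0 (fun _ => f))
    (∑ G : GG m, a G.1 * homDensity G.1 (stepK p c)) (∑ G : GG m, a G.1 * homDensity G.1 f)
  linarith

/-- Taylor's theorem for class functions. Let `F : W → ℝ` be a
`C^{n+1}` class function.  (i) Taylor's remainder formula holds: for each graphon `f`
there is `c_f ∈ [0,1]` with
`F(f) - Σ_{m ≤ n} d^mF(0;f,…,f)/m! = d^{n+1}F(c_f·f; f,…,f)/(n+1)!`.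
(ii) There are unique coefficients `a_H`, indexed by the isomorphism classes of
multigraphs with at most `n` edges and no isolated vertices, with
`d^mF(0;f,…,f)/m! = Σ_{|E(H)|=m} a_H t(H,f)` for every `m ≤ n` and every `f` in the
union of the `S_[0,1]`-translates of the step graphons; and if moreover all the
functions `f ↦ d^mF(0;f,…,f)` are `L¹`-continuous, this identity holds on all of `W`. -/
theorem stmt16 (n : ℕ) (F : Kern → ℝ) (hclass : IsClassFun F)
    (hC : IsCn Graphons F (n + 1)) :
    (∀ f ∈ Graphons, ∃ c ∈ Set.Icc (0:ℝ) 1,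
      F f - ∑ m ∈ Finset.range (n + 1),
          (1 / (Nat.factorial m : ℝ)) * gD Graphons F m 0 (fun _ => f)
        = gD Graphons F (n + 1) (c • f) (fun _ => f) / (Nat.factorial (n + 1) : ℝ)) ∧
    (∃! a : MG → ℝ, GoodCoeffs n a ∧
      ∀ m : ℕ, m ≤ n → ∀ f ∈ StepTranslates,
        (1 / (Nat.factorial m : ℝ)) * gD Graphons F m 0 (fun _ => f)
          = ∑ᶠ G ∈ {G : MG | G.ne = m}, a G * homDensity G f) ∧
    (∀ a : MG → ℝ, GoodCoeffs n a →
      (∀ m : ℕ, m ≤ n → ∀ f ∈ StepTranslates,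
        (1 / (Nat.factorial m : ℝ)) * gD Graphons F m 0 (fun _ => f)
          = ∑ᶠ G ∈ {G : MG | G.ne = m}, a G * homDensity G f) →
      (∀ m : ℕ, m ≤ n → L1ContOn (fun f => gD Graphons F m 0 (fun _ => f))) →
      ∀ m : ℕ, m ≤ n → ∀ f ∈ Graphons,
        (1 / (Nat.factorial m : ℝ)) * gD Graphons F m 0 (fun _ => f)
          = ∑ᶠ G ∈ {G : MG | G.ne = m}, a G * homDensity G f) := by
  refine ⟨fun f hf => taylor_part hC hf, ?_, ?_⟩
  · obtain ⟨a, ha, ha'⟩ := exists_good hclass hC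
    exact ⟨a, ⟨ha, ha'⟩, fun b hb => good_unique hb.1 ha hb.2 ha'⟩
  · intro a ha ha' hL m hm f hf
    exact good_extend ha ha' hm (hL m hm) hf
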